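/- arXiv:1410.7150 — 4 statements merged into one kernel-verified Lean document; each statement's English description precedes it below -/
import Mathlib

section
/- Let p ≥ 3 be an integer and for g ∈ ℕ let G_sym(p,g) denote the number of symmetric numerical semigroups H with p ∈ H and genus g(H) = g. Then g ↦ G_sym(p,g) is a quasi-polynomial of degree ⌊p/2⌋ − 1. -/
/-- A numerical semigroup: a submonoid of (ℕ,+) with finite complement. -/
def IsNumericalSemigroup (H : Set ℕ) : Prop :=
  0 ∈ H ∧ (∀ a ∈ H, ∀ b ∈ H, a + b ∈ H) ∧ Hᶜ.Finite

/-- The genus: number of gaps. -/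
noncomputable def genus (H : Set ℕ) : ℕ := Hᶜ.ncard

/-- The Frobenius number, as an integer (so that F(ℕ) = -1). -/
noncomputable def frobNum (H : Set ℕ) : ℤ :=
  sSup (insert (-1) ((fun n : ℕ => (n : ℤ)) '' Hᶜ))

/-- `H` is symmetric if `2 g(H) = F(H) + 1`. -/
def IsSymmetricNS (H : Set ℕ) : Prop := 2 * (genus H : ℤ) = frobNum H + 1

/-- `G_sym p g`: the number of symmetric numerical semigroups containing `p` of genus `g`. -/
noncomputable def countGenusSym (p g : ℕ) : ℕ :=
  {H : Set ℕ | IsNumericalSemigroup H ∧ p ∈ H ∧ IsSymmetricNS H ∧ genus H = g}.ncard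

open Polynomial

/-- A function on `ℤ` which agrees with a polynomial on each residue class of some modulus. -/
def IsQuasiPoly (q : ℤ → ℝ) : Prop :=
  ∃ (M : ℤ) (c : ℤ → ℝ[X]), 0 < M ∧ Function.Periodic c M ∧ ∀ n, q n = (c n).eval (n : ℝ)

namespace IsQuasiPoly

lemma of_periodic {φ : ℤ → ℝ} {M : ℤ} (hM : 0 < M) (h : Function.Periodic φ M) :
    IsQuasiPoly φ :=
  ⟨M, fun n => C (φ n), hM, fun n => by simp [h n], fun n => by simp⟩

lemma const (r : ℝ) : IsQuasiPoly fun _ => r := of_periodic one_pos fun _ => rfl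

lemma intCast : IsQuasiPoly fun n => (n : ℝ) :=
  ⟨1, fun _ => X, one_pos, fun _ => rfl, fun n => by simp⟩

lemma exists_common {q₁ q₂ : ℤ → ℝ} (h₁ : IsQuasiPoly q₁) (h₂ : IsQuasiPoly q₂) :
    ∃ (M : ℤ) (c₁ c₂ : ℤ → ℝ[X]), 0 < M ∧ Function.Periodic c₁ M ∧ Function.Periodic c₂ M ∧
      (∀ n, q₁ n = (c₁ n).eval (n : ℝ)) ∧ ∀ n, q₂ n = (c₂ n).eval (n : ℝ) := by
  obtain ⟨M₁, c₁, hM₁, hp₁, hc₁⟩ := h₁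
  obtain ⟨M₂, c₂, hM₂, hp₂, hc₂⟩ := h₂
  refine ⟨M₁ * M₂, c₁, c₂, mul_pos hM₁ hM₂, ?_, ?_, hc₁, hc₂⟩
  · rw [mul_comm]
    exact hp₁.int_mul M₂
  · exact hp₂.int_mul M₁

lemma add {q₁ q₂ : ℤ → ℝ} (h₁ : IsQuasiPoly q₁) (h₂ : IsQuasiPoly q₂) :
    IsQuasiPoly (q₁ + q₂) := by
  obtain ⟨M, c₁, c₂, hM, hp₁, hp₂, hc₁, hc₂⟩ := exists_common h₁ h₂
  exact ⟨M, fun n => c₁ n + c₂ n, hM, fun n => by simp [hp₁ n, hp₂ n],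
    fun n => by simp [hc₁, hc₂]⟩

lemma mul {q₁ q₂ : ℤ → ℝ} (h₁ : IsQuasiPoly q₁) (h₂ : IsQuasiPoly q₂) :
    IsQuasiPoly (q₁ * q₂) := by
  obtain ⟨M, c₁, c₂, hM, hp₁, hp₂, hc₁, hc₂⟩ := exists_common h₁ h₂
  exact ⟨M, fun n => c₁ n * c₂ n, hM, fun n => by simp [hp₁ n, hp₂ n],
    fun n => by simp [hc₁, hc₂]⟩

lemma sum {ι : Type*} (s : Finset ι) {q : ι → ℤ → ℝ} (h : ∀ i, IsQuasiPoly (q i)) :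
    IsQuasiPoly fun n => ∑ i ∈ s, q i n := by
  classical
  induction s using Finset.induction_on with
  | empty => simpa using const 0
  | insert i s hi ih =>
    simp only [Finset.sum_insert hi]
    exact (h i).add ih

lemma comp_affine {q : ℤ → ℝ} (h : IsQuasiPoly q) (a b : ℤ) :
    IsQuasiPoly fun n => q (a * n + b) := by
  obtain ⟨M, c, hM, hp, hc⟩ := h
  refine ⟨M, fun n => (c (a * n + b)).comp (C (a : ℝ) * X + C (b : ℝ)), hM, fun n => ?_,
    fun n => by simp [hc]⟩
  have := hp.int_mul a (a * n + b)
  simp only [Int.cast_id] at this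
  simp only [show a * (n + M) + b = a * n + b + a * M by ring, this]

lemma comp_ediv {q : ℤ → ℝ} (h : IsQuasiPoly q) {a : ℤ} (ha : 0 < a) :
    IsQuasiPoly fun n => q (n / a) := by
  obtain ⟨M, c, hM, hp, hc⟩ := h
  refine ⟨a * M, fun n => (c (n / a)).comp (C (a : ℝ)⁻¹ * (X - C ((n % a : ℤ) : ℝ))),
    mul_pos ha hM, fun n => ?_, fun n => ?_⟩
  · simp only [Int.add_mul_ediv_left n M ha.ne', hp (n / a), Int.add_mul_emod_self_left]
  · have ha' : (a : ℝ) ≠ 0 := by exact_mod_cast ha.ne'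
    have : (n : ℝ) = a * ((n / a : ℤ) : ℝ) + ((n % a : ℤ) : ℝ) := by
      exact_mod_cast (Int.mul_ediv_add_emod n a).symm
    have h2 : (a : ℝ)⁻¹ * ((n : ℝ) - ((n % a : ℤ) : ℝ)) = ((n / a : ℤ) : ℝ) := by
      rw [this]; field_simp; ring
    simp only [hc, eval_comp, eval_mul, eval_C, eval_sub, eval_X, h2]

end IsQuasiPoly

lemma Polynomial.exists_antidifference (p : ℝ[X]) :
    ∃ B : ℝ[X], ∀ z : ℤ, B.eval ((z : ℝ) + 1) - B.eval (z : ℝ) = p.eval (z : ℝ) := by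
  induction p using Polynomial.induction_on' with
  | add p q hp hq =>
    obtain ⟨A, hA⟩ := hp
    obtain ⟨B, hB⟩ := hq
    exact ⟨A + B, fun z => by simp only [eval_add, ← hA, ← hB]; ring⟩
  | monomial n a =>
    refine ⟨C (a / (n + 1)) * (Polynomial.bernoulli (n + 1)).map (algebraMap ℚ ℝ), fun z => ?_⟩
    have key : ∀ x : ℚ, ((Polynomial.bernoulli (n + 1)).map (algebraMap ℚ ℝ)).eval (x : ℝ)
        = (((Polynomial.bernoulli (n + 1)).eval x : ℚ) : ℝ) := fun x => by
      rw [eval_map_algebraMap]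
      exact aeval_algebraMap_apply_eq_algebraMap_eval x _
    have h1 := key (1 + z)
    have h2 := key z
    rw [Polynomial.bernoulli_eval_one_add] at h1
    push_cast at h1 h2
    have hn : (n : ℝ) + 1 ≠ 0 := by positivity
    rw [add_comm (z : ℝ) 1]
    simp only [eval_mul, eval_C, h1, h2, eval_monomial]
    field_simp
    ring

lemma IsQuasiPoly.exists_antidifference {q : ℤ → ℝ} (h : IsQuasiPoly q) :
    ∃ P, IsQuasiPoly P ∧ ∀ n, P (n + 1) - P n = q n := by
  obtain ⟨M, c, hM, hp, hc⟩ := h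
  choose B hB using fun r : ℤ =>
    ((c r).comp (C (M : ℝ) * X + C (r : ℝ))).exists_antidifference
  have hQ : ∀ r, IsQuasiPoly fun n : ℤ => (B r).eval ((-((r - n) / M) : ℤ) : ℝ) := fun r => by
    have h1 : IsQuasiPoly fun n : ℤ => (B r).eval (n : ℝ) :=
      ⟨1, fun _ => B r, one_pos, fun _ => rfl, fun _ => rfl⟩
    have := ((h1.comp_affine (-1) 0).comp_ediv hM).comp_affine (-1) r
    convert this using 3
    ring_nf
  refine ⟨_, IsQuasiPoly.sum (Finset.Ico 0 M) hQ, fun n => ?_⟩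
  rw [← Finset.sum_sub_distrib]
  have hn : n % M ∈ Finset.Ico 0 M :=
    Finset.mem_Ico.2 ⟨Int.emod_nonneg _ hM.ne', Int.emod_lt_of_pos _ hM⟩
  have hd := Int.mul_ediv_add_emod n M
  set r := n % M with hr
  set k := n / M with hk
  rw [Finset.sum_eq_single_of_mem r hn]
  · have e1 : (r - n) / M = -k := by
      rw [show r - n = M * (-k) by linarith]; exact Int.mul_ediv_cancel_left _ hM.ne'
    have e2 : (r - (n + 1)) / M = -k - 1 := by
      rw [show r - (n + 1) = (-1) + M * (-k) by linarith, Int.add_mul_ediv_left _ _ hM.ne',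
        Int.ediv_eq_neg_one_of_neg_of_le (by norm_num) (by linarith)]
      ring
    rw [e1, e2]
    have := hB r k
    have hcr : c r = c n := by
      have := hp.int_mul k r
      rw [← this]; congr 1; simp; linarith
    have hnr : (M : ℝ) * k + r = n := by exact_mod_cast hd
    simp only [eval_comp, eval_add, eval_mul, eval_C, eval_X, hnr] at this
    rw [hc, ← hcr, ← this]
    push_cast
    ring_nf
  · intro s hs hsr
    rw [Finset.mem_Ico] at hs hn
    have : (s - (n + 1)) / M = (s - n) / M := by
      rcases lt_or_gt_of_ne hsr with h | h
      · rw [show s - (n + 1) = (s - r - 1) + M * (-k) by linarith,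
          show s - n = (s - r) + M * (-k) by linarith, Int.add_mul_ediv_left _ _ hM.ne',
          Int.add_mul_ediv_left _ _ hM.ne',
          Int.ediv_eq_neg_one_of_neg_of_le (by linarith) (by linarith),
          Int.ediv_eq_neg_one_of_neg_of_le (by linarith) (by linarith)]
      · rw [show s - (n + 1) = (s - r - 1) + M * (-k) by linarith,
          show s - n = (s - r) + M * (-k) by linarith, Int.add_mul_ediv_left _ _ hM.ne',
          Int.add_mul_ediv_left _ _ hM.ne',
          Int.ediv_eq_zero_of_lt (by linarith) (by linarith),
          Int.ediv_eq_zero_of_lt (by linarith) (by linarith)]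
    rw [this, sub_self]

lemma IsQuasiPoly.sum_Ico {q P : ℤ → ℝ} (h : ∀ n, P (n + 1) - P n = q n) {s t : ℤ} (hst : s ≤ t) :
    ∑ y ∈ Finset.Ico s t, q y = P t - P s := by
  induction t, hst using Int.leInduction with
  | base => simp
  | succ t ht ih =>
    rw [← Finset.insert_Ico_right_eq_Ico_add_one ht, Finset.sum_insert (by simp), ih, ← h]
    ring

/-- The functions on a lattice generated by integral linear forms, periodic functions of such forms
and indicators of open half-spaces through the origin. -/
def piecewiseQuasiPoly (V : Type*) [AddCommGroup V] : Subalgebra ℝ (V → ℝ) :=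
  Algebra.adjoin ℝ
    ({f | ∃ ℓ : V →+ ℤ, f = fun v => (ℓ v : ℝ)} ∪
      {f | ∃ (ℓ : V →+ ℤ) (φ : ℤ → ℝ) (M : ℤ), 0 < M ∧ Function.Periodic φ M ∧
        f = fun v => φ (ℓ v)} ∪
      {f | ∃ ℓ : V →+ ℤ, f = {v | 0 < ℓ v}.indicator 1})

/-- Sets whose indicator is piecewise quasi-polynomial. -/
def IsPiecewiseSet {V : Type*} [AddCommGroup V] (s : Set V) : Prop :=
  s.indicator 1 ∈ piecewiseQuasiPoly V

section
variable {V W : Type*} [AddCommGroup V] [AddCommGroup W]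

namespace piecewiseQuasiPoly

lemma linear_mem (ℓ : V →+ ℤ) : (fun v => (ℓ v : ℝ)) ∈ piecewiseQuasiPoly V :=
  Algebra.subset_adjoin (Or.inl (Or.inl ⟨ℓ, rfl⟩))

lemma periodic_mem (ℓ : V →+ ℤ) {φ : ℤ → ℝ} {M : ℤ} (hM : 0 < M) (h : Function.Periodic φ M) :
    (fun v => φ (ℓ v)) ∈ piecewiseQuasiPoly V :=
  Algebra.subset_adjoin (Or.inl (Or.inr ⟨ℓ, φ, M, hM, h, rfl⟩))

lemma const_mem (r : ℝ) : (fun _ => r) ∈ piecewiseQuasiPoly V :=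
  (piecewiseQuasiPoly V).algebraMap_mem r

lemma comp_mem {f : V → ℝ} (hf : f ∈ piecewiseQuasiPoly V) (L : W →+ V) :
    f ∘ L ∈ piecewiseQuasiPoly W := by
  induction hf using Algebra.adjoin_induction with
  | mem f hf =>
    rcases hf with (⟨ℓ, rfl⟩ | ⟨ℓ, φ, M, hM, hφ, rfl⟩) | ⟨ℓ, rfl⟩
    · exact linear_mem (ℓ.comp L)
    · exact periodic_mem (ℓ.comp L) hM hφ
    · exact Algebra.subset_adjoin (Or.inr ⟨ℓ.comp L, rfl⟩)
  | algebraMap r => exact const_mem r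
  | add f g _ _ hf hg => exact add_mem hf hg
  | mul f g _ _ hf hg => exact mul_mem hf hg

end piecewiseQuasiPoly

namespace IsPiecewiseSet

lemma pos (ℓ : V →+ ℤ) : IsPiecewiseSet {v | 0 < ℓ v} :=
  Algebra.subset_adjoin (Or.inr ⟨ℓ, rfl⟩)

lemma compl {s : Set V} (hs : IsPiecewiseSet s) : IsPiecewiseSet sᶜ := by
  unfold IsPiecewiseSet
  rw [Set.indicator_compl]
  exact sub_mem (one_mem _) hs

lemma inter {s t : Set V} (hs : IsPiecewiseSet s) (ht : IsPiecewiseSet t) :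
    IsPiecewiseSet (s ∩ t) := by
  unfold IsPiecewiseSet
  rw [Set.inter_indicator_one]
  exact mul_mem hs ht

lemma univ : IsPiecewiseSet (Set.univ : Set V) := by
  unfold IsPiecewiseSet
  rw [Set.indicator_univ]
  exact one_mem _

lemma imp {s t : Set V} (hs : IsPiecewiseSet s) (ht : IsPiecewiseSet t) :
    IsPiecewiseSet {v | v ∈ s → v ∈ t} := by
  convert (hs.inter ht.compl).compl using 1
  ext v
  simp

lemma forall_finite {ι : Type*} [Finite ι] {s : ι → Set V} (h : ∀ i, IsPiecewiseSet (s i)) :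
    IsPiecewiseSet {v | ∀ i, v ∈ s i} := by
  classical
  cases nonempty_fintype ι
  have (S : Finset ι) : IsPiecewiseSet {v | ∀ i ∈ S, v ∈ s i} := by
    induction S using Finset.induction_on with
    | empty => simpa using univ
    | insert i S _ ih =>
      simp only [Finset.forall_mem_insert]
      exact (h i).inter ih
  simpa using this Finset.univ

lemma lt (ℓ₁ ℓ₂ : V →+ ℤ) : IsPiecewiseSet {v | ℓ₁ v < ℓ₂ v} := by
  simpa using pos (ℓ₂ - ℓ₁)

lemma le (ℓ₁ ℓ₂ : V →+ ℤ) : IsPiecewiseSet {v | ℓ₁ v ≤ ℓ₂ v} := by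
  convert (lt ℓ₂ ℓ₁).compl using 1
  ext v
  simp

lemma eq (ℓ₁ ℓ₂ : V →+ ℤ) : IsPiecewiseSet {v | ℓ₁ v = ℓ₂ v} := by
  convert (le ℓ₁ ℓ₂).inter (le ℓ₂ ℓ₁) using 1
  ext v
  exact le_antisymm_iff

lemma periodic (ℓ : V →+ ℤ) {A : Set ℤ} {M : ℤ} (hM : 0 < M)
    (h : ∀ n, n + M ∈ A ↔ n ∈ A) : IsPiecewiseSet {v | ℓ v ∈ A} :=
  piecewiseQuasiPoly.periodic_mem ℓ (φ := A.indicator 1) hM fun n => by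
    classical
    simp [Set.indicator_apply, h]

end IsPiecewiseSet

lemma IsQuasiPoly.comp_mem_piecewiseQuasiPoly {q : ℤ → ℝ} (hq : IsQuasiPoly q) (ℓ : V →+ ℤ) :
    (fun v => q (ℓ v)) ∈ piecewiseQuasiPoly V := by
  obtain ⟨M, c, hM, hp, hc⟩ := hq
  have hpoly (p : ℝ[X]) : (fun v => p.eval (ℓ v : ℝ)) ∈ piecewiseQuasiPoly V := by
    induction p using Polynomial.induction_on' with
    | add p q hp hq =>
      simp only [eval_add]
      exact add_mem hp hq
    | monomial n a =>
      simp only [eval_monomial]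
      exact mul_mem (piecewiseQuasiPoly.const_mem a)
        (pow_mem (piecewiseQuasiPoly.linear_mem ℓ) n)
  have key : (fun v => q (ℓ v)) = ∑ r ∈ Finset.Ico 0 M,
      (fun v => if ℓ v % M = r then (1 : ℝ) else 0) * fun v => (c r).eval (ℓ v : ℝ) := by
    ext v
    have hn : ℓ v % M ∈ Finset.Ico 0 M :=
      Finset.mem_Ico.2 ⟨Int.emod_nonneg _ hM.ne', Int.emod_lt_of_pos _ hM⟩
    simp only [Finset.sum_apply, Pi.mul_apply, ite_mul, one_mul, zero_mul, Finset.sum_ite_eq,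
      if_pos hn, hc]
    have := hp.int_mul (ℓ v / M) (ℓ v % M)
    rw [← this]
    congr 2
    have := Int.mul_ediv_add_emod (ℓ v) M
    simp only [Int.cast_id]
    linarith
  rw [key]
  exact sum_mem fun r _ => mul_mem
    (piecewiseQuasiPoly.periodic_mem ℓ (φ := fun n => if n % M = r then (1 : ℝ) else 0) hM
      fun n => by simp) (hpoly _)

end

section
variable {V : Type*} [AddCommGroup V]

/-- The indicator of the region where the last coordinate lies beyond a linear threshold, which
is included if `ε = 1` and excluded if `ε = 0`. -/
noncomputable def rayIndicator (ℓ : V →+ ℤ) (a ε : ℤ) : V × ℤ → ℝ :=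
  {x | ℓ x.1 < a * x.2 + ε}.indicator 1

/-- Products of a piecewise quasi-polynomial in the first coordinate, a quasi-polynomial in the
last coordinate, and the indicator of a ray in the last coordinate. -/
def rayTerms (V : Type*) [AddCommGroup V] : Set (V × ℤ → ℝ) :=
  {f | ∃ g ∈ piecewiseQuasiPoly V, ∃ q, IsQuasiPoly q ∧ ∃ (ℓ : V →+ ℤ) (a ε : ℤ), 0 < a ∧
    (ε = 0 ∨ ε = 1) ∧ f = fun x => g x.1 * q x.2 * rayIndicator ℓ a ε x}

lemma exists_rayIndicator_mul (ℓ k : V →+ ℤ) {a b ε δ : ℤ} (ha : 0 < a) (hb : 0 < b)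
    (hε : ε = 0 ∨ ε = 1) (hδ : δ = 0 ∨ δ = 1) :
    ∃ A : Set V, IsPiecewiseSet A ∧ ∀ x, rayIndicator ℓ a ε x * rayIndicator k b δ x =
      A.indicator 1 x.1 * rayIndicator ℓ a ε x + Aᶜ.indicator 1 x.1 * rayIndicator k b δ x := by
  classical
  rcases hε with rfl | rfl
  · refine ⟨{v | a * k v ≤ b * ℓ v}, by simpa using IsPiecewiseSet.le (a • k) (b • ℓ), ?_⟩
    rintro ⟨v, y⟩
    simp only [rayIndicator, Set.indicator_apply, Set.mem_ofPred_eq, Set.mem_compl_iff,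
      Pi.one_apply, add_zero]
    by_cases h : a * k v ≤ b * ℓ v
    · by_cases h1 : ℓ v < a * y
      · have : k v < b * y + δ := by
          have : k v < b * y := by
            by_contra! h3
            nlinarith [mul_le_mul_of_nonneg_left h3 ha.le, mul_lt_mul_of_pos_left h1 hb]
          rcases hδ with rfl | rfl <;> linarith
        simp [h, h1, this]
      · simp [h, h1]
    · by_cases h1 : k v < b * y + δ
      · have : ℓ v < a * y := by
          have h2 : k v ≤ b * y := by rcases hδ with rfl | rfl <;> linarith
          by_contra! h3
          nlinarith [mul_le_mul_of_nonneg_left h3 hb.le, mul_le_mul_of_nonneg_left h2 ha.le]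
        simp [h, h1, this]
      · simp [h, h1]
  · refine ⟨{v | a * k v < b * ℓ v}, by simpa using IsPiecewiseSet.lt (a • k) (b • ℓ), ?_⟩
    rintro ⟨v, y⟩
    simp only [rayIndicator, Set.indicator_apply, Set.mem_ofPred_eq, Set.mem_compl_iff,
      Pi.one_apply]
    by_cases h : a * k v < b * ℓ v
    · by_cases h1 : ℓ v < a * y + 1
      · have : k v < b * y + δ := by
          have : k v < b * y := by
            by_contra! h3
            nlinarith [mul_le_mul_of_nonneg_left h3 ha.le,
              mul_le_mul_of_nonneg_left (Int.lt_add_one_iff.1 h1) hb.le]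
          rcases hδ with rfl | rfl <;> linarith
        simp [h, h1, this]
      · simp [h, h1]
    · by_cases h1 : k v < b * y + δ
      · have : ℓ v < a * y + 1 := by
          have h2 : k v ≤ b * y := by rcases hδ with rfl | rfl <;> linarith
          rw [Int.lt_add_one_iff]
          by_contra! h3
          nlinarith [mul_lt_mul_of_pos_left h3 hb, mul_le_mul_of_nonneg_left h2 ha.le]
        simp [h, h1, this]
      · simp [h, h1]

lemma mul_mem_span_rayTerms {f g : V × ℤ → ℝ} (hf : f ∈ Submodule.span ℝ (rayTerms V))
    (hg : g ∈ Submodule.span ℝ (rayTerms V)) : f * g ∈ Submodule.span ℝ (rayTerms V) := by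
  have h := Submodule.mul_mem_mul hf hg
  rw [Submodule.span_mul_span] at h
  refine Submodule.span_le.2 ?_ h
  rintro _ ⟨_, ⟨g₁, hg₁, q₁, hq₁, ℓ, a, ε, ha, hε, rfl⟩,
    _, ⟨g₂, hg₂, q₂, hq₂, k, b, δ, hb, hδ, rfl⟩, rfl⟩
  obtain ⟨A, hA, hmul⟩ := exists_rayIndicator_mul ℓ k ha hb hε hδ
  have : (fun x : V × ℤ => g₁ x.1 * q₁ x.2 * rayIndicator ℓ a ε x) *
        (fun x => g₂ x.1 * q₂ x.2 * rayIndicator k b δ x) =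
      (fun x => (g₁ * g₂ * A.indicator 1 : V → ℝ) x.1 * (q₁ * q₂) x.2 * rayIndicator ℓ a ε x) +
      fun x => (g₁ * g₂ * Aᶜ.indicator 1 : V → ℝ) x.1 * (q₁ * q₂) x.2 * rayIndicator k b δ x := by
    ext x
    simp only [Pi.mul_apply, Pi.add_apply]
    linear_combination g₁ x.1 * q₁ x.2 * g₂ x.1 * q₂ x.2 * hmul x
  change _ * _ ∈ _
  rw [this]
  exact add_mem
    (Submodule.subset_span ⟨_, mul_mem (mul_mem hg₁ hg₂) hA, _, hq₁.mul hq₂, ℓ, a, ε, ha, hε, rfl⟩)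
    (Submodule.subset_span
      ⟨_, mul_mem (mul_mem hg₁ hg₂) hA.compl, _, hq₁.mul hq₂, k, b, δ, hb, hδ, rfl⟩)

lemma rayIndicator_mem_span (ℓ : V →+ ℤ) {a ε : ℤ} (ha : 0 < a) (hε : ε = 0 ∨ ε = 1) :
    rayIndicator ℓ a ε ∈ Submodule.span ℝ (rayTerms V) :=
  Submodule.subset_span ⟨1, one_mem _, fun _ => 1, IsQuasiPoly.const 1, ℓ, a, ε, ha, hε, by
    ext x; simp⟩

lemma mul_nonneg_mem_span_rayTerms {f : V × ℤ → ℝ} (hf : f ∈ piecewiseQuasiPoly (V × ℤ)) :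
    f * rayIndicator 0 1 1 ∈ Submodule.span ℝ (rayTerms V) := by
  have hterm {g : V → ℝ} (hg : g ∈ piecewiseQuasiPoly V) {q : ℤ → ℝ} (hq : IsQuasiPoly q) :
      (fun x : V × ℤ => g x.1 * q x.2) * rayIndicator 0 1 1 ∈ Submodule.span ℝ (rayTerms V) :=
    Submodule.subset_span ⟨g, hg, q, hq, 0, 1, 1, one_pos, Or.inr rfl, rfl⟩
  have hlin (ℓ : V × ℤ →+ ℤ) (x : V × ℤ) :
      ℓ x = ℓ.comp (AddMonoidHom.inl V ℤ) x.1 + ℓ (0, 1) * x.2 := by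
    have : x = (x.1, 0) + x.2 • ((0 : V), (1 : ℤ)) := by ext <;> simp
    conv_lhs => rw [this, map_add, map_zsmul]
    simp [mul_comm]
  induction hf using Algebra.adjoin_induction with
  | mem f hf =>
    rcases hf with (⟨ℓ, rfl⟩ | ⟨ℓ, φ, M, hM, hφ, rfl⟩) | ⟨ℓ, rfl⟩
    · convert add_mem
        (hterm (piecewiseQuasiPoly.linear_mem (ℓ.comp (AddMonoidHom.inl V ℤ)))
          (IsQuasiPoly.const 1))
        (hterm (piecewiseQuasiPoly.const_mem (ℓ (0, 1) : ℝ)) IsQuasiPoly.intCast) using 1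
      rw [← add_mul]
      congr 1
      ext x
      simp [hlin ℓ x]
    · have key : (fun x : V × ℤ => φ (ℓ x)) = ∑ r ∈ Finset.Ico 0 M, fun x : V × ℤ =>
          (if ℓ.comp (AddMonoidHom.inl V ℤ) x.1 % M = r then (1 : ℝ) else 0) *
            φ (ℓ (0, 1) * x.2 + r) := by
        ext x
        have hn (n : ℤ) : n % M ∈ Finset.Ico 0 M :=
          Finset.mem_Ico.2 ⟨Int.emod_nonneg _ hM.ne', Int.emod_lt_of_pos _ hM⟩
        have hper (n m : ℤ) : φ (n + m) = φ (m + n % M) := by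
          rw [← hφ.int_mul (n / M) (m + n % M)]
          congr 1
          have := Int.mul_ediv_add_emod n M
          simp only [Int.cast_id]
          linarith
        simp only [Finset.sum_apply, ite_mul, one_mul, zero_mul, Finset.sum_ite_eq]
        rw [if_pos (hn _), hlin ℓ x]
        exact hper _ _
      rw [key, Finset.sum_mul]
      exact sum_mem fun r _ => hterm
        (piecewiseQuasiPoly.periodic_mem (ℓ.comp (AddMonoidHom.inl V ℤ))
          (φ := fun n => if n % M = r then (1 : ℝ) else 0) hM fun n => by simp)
        ((IsQuasiPoly.of_periodic hM hφ).comp_affine _ _)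
    · rcases lt_trichotomy (ℓ (0, 1)) 0 with h | h | h
      · have hray := rayIndicator_mem_span (ℓ.comp (AddMonoidHom.inl V ℤ))
          (neg_pos.2 h) (Or.inr rfl)
        have hnn := rayIndicator_mem_span (0 : V →+ ℤ) one_pos (Or.inr rfl)
        convert sub_mem hnn (mul_mem_span_rayTerms hray hnn) using 1
        rw [← one_sub_mul]
        congr 1
        rw [rayIndicator, ← Set.indicator_compl]
        congr 1
        ext x
        simp only [Set.mem_ofPred_eq, Set.mem_compl_iff, hlin ℓ x]
        constructor <;> intro _ <;> linarith
      · convert hterm (IsPiecewiseSet.pos (ℓ.comp (AddMonoidHom.inl V ℤ)))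
          (IsQuasiPoly.const 1) using 2
        ext x
        simp only [Set.indicator, Set.mem_ofPred_eq, hlin ℓ x, h, zero_mul, add_zero, mul_one]
        split_ifs <;> rfl
      · have hray := rayIndicator_mem_span (-ℓ.comp (AddMonoidHom.inl V ℤ)) h (Or.inl rfl)
        have hnn := rayIndicator_mem_span (0 : V →+ ℤ) one_pos (Or.inr rfl)
        convert mul_mem_span_rayTerms hray hnn using 2
        rw [rayIndicator]
        congr 1
        ext x
        simp only [Set.mem_ofPred_eq, hlin ℓ x, AddMonoidHom.neg_apply]
        constructor <;> intro _ <;> linarith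
  | algebraMap r =>
    convert hterm (piecewiseQuasiPoly.const_mem r) (IsQuasiPoly.const 1) using 2
    ext x
    simp
  | add f g _ _ hf hg =>
    rw [add_mul]
    exact add_mem hf hg
  | mul f g _ _ hf hg =>
    convert mul_mem_span_rayTerms hf hg using 1
    rw [mul_mul_mul_comm]
    congr 1
    rw [rayIndicator, ← Set.inter_indicator_one, Set.inter_self]

lemma sum_Ico_rayTerm_mem {f : V × ℤ → ℝ} (hf : f ∈ rayTerms V) :
    (fun x : V × ℤ => ∑ y ∈ Finset.Ico 0 x.2, f (x.1, y)) ∈ piecewiseQuasiPoly (V × ℤ) := by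
  classical
  obtain ⟨g, hg, q, hq, ℓ, a, ε, ha, hε, rfl⟩ := hf
  obtain ⟨P, hP, hPq⟩ := hq.exists_antidifference
  set ℓ' : V × ℤ →+ ℤ := ℓ.comp (AddMonoidHom.fst V ℤ)
  set t : V × ℤ →+ ℤ := AddMonoidHom.snd V ℤ
  have hg' : (fun x : V × ℤ => g x.1) ∈ piecewiseQuasiPoly (V × ℤ) :=
    piecewiseQuasiPoly.comp_mem hg (AddMonoidHom.fst V ℤ)
  have hlt : ∀ m y : ℤ, m < a * y + ε ↔ (m - ε) / a + 1 ≤ y := fun m y => by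
    rw [Int.add_one_le_iff, Int.ediv_lt_iff_lt_mul ha, mul_comm y a]
    constructor <;> intro _ <;> linarith
  have hS : IsPiecewiseSet {x : V × ℤ | ℓ' x < ε} := by
    rcases hε with rfl | rfl
    · exact IsPiecewiseSet.lt ℓ' 0
    · convert IsPiecewiseSet.le ℓ' 0 using 1
      ext x
      simp only [Set.mem_ofPred_eq, AddMonoidHom.zero_apply]
      omega
  have hT : IsPiecewiseSet {x : V × ℤ | ℓ' x < a * t x + ε} := by
    rcases hε with rfl | rfl
    · simpa using IsPiecewiseSet.lt ℓ' (a • t)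
    · simpa [Int.lt_add_one_iff] using IsPiecewiseSet.le ℓ' (a • t)
  have hU : IsPiecewiseSet {x : V × ℤ | 0 ≤ t x} := IsPiecewiseSet.le 0 t
  have hPt : (fun x : V × ℤ => P (t x)) ∈ piecewiseQuasiPoly (V × ℤ) :=
    hP.comp_mem_piecewiseQuasiPoly t
  have hPs : (fun x : V × ℤ => P ((ℓ' x - ε) / a + 1)) ∈ piecewiseQuasiPoly (V × ℤ) := by
    have := ((hP.comp_affine 1 1).comp_ediv ha).comp_affine 1 (-ε)
    convert this.comp_mem_piecewiseQuasiPoly ℓ' using 3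
    ring_nf
  convert mul_mem hg' (add_mem
    (mul_mem hS (mul_mem hU (sub_mem hPt (piecewiseQuasiPoly.const_mem (P 0)))))
    (mul_mem hS.compl (mul_mem hT (sub_mem hPt hPs)))) using 1
  ext ⟨v, n⟩
  simp only [Pi.mul_apply, Pi.add_apply, Pi.sub_apply, rayIndicator, mul_assoc,
    ← Finset.mul_sum, Set.indicator_apply, Set.mem_ofPred_eq, Set.mem_compl_iff, hlt]
  congr 1
  change _ = (if ℓ v < ε then (1 : ℝ) else 0) * ((if 0 ≤ n then (1 : ℝ) else 0) * (P n - P 0)) +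
    (if ¬ ℓ v < ε then (1 : ℝ) else 0) *
      ((if (ℓ v - ε) / a + 1 ≤ n then (1 : ℝ) else 0) * (P n - P ((ℓ v - ε) / a + 1)))
  have h0 := hlt (ℓ v) 0
  rw [mul_zero, zero_add] at h0
  simp only [h0]
  have main (s : ℤ) : ∑ y ∈ Finset.Ico 0 n, q y * (if s ≤ y then (1 : ℝ) else 0) =
      (if s ≤ 0 then (1 : ℝ) else 0) * ((if 0 ≤ n then (1 : ℝ) else 0) * (P n - P 0)) +
      (if ¬ s ≤ 0 then (1 : ℝ) else 0) * ((if s ≤ n then (1 : ℝ) else 0) * (P n - P s)) := by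
    simp only [mul_ite, mul_one, mul_zero, ← Finset.sum_filter]
    by_cases hs : s ≤ 0
    · rw [Finset.filter_true_of_mem fun y hy => hs.trans (Finset.mem_Ico.1 hy).1]
      by_cases hn : 0 ≤ n
      · simp [hs, hn, IsQuasiPoly.sum_Ico hPq hn]
      · simp [hs, hn, Finset.Ico_eq_empty_of_le (not_le.1 hn).le]
    · have : (Finset.Ico 0 n).filter (s ≤ ·) = Finset.Ico s n := by
        ext y
        simp only [Finset.mem_filter, Finset.mem_Ico]
        omega
      rw [this]
      by_cases hn : s ≤ n
      · simp [hs, hn, IsQuasiPoly.sum_Ico hPq hn]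
      · simp [hs, hn, Finset.Ico_eq_empty_of_le (not_le.1 hn).le]
  convert main _
  rfl

lemma sum_Ico_mem_piecewiseQuasiPoly {f : V × ℤ → ℝ} (hf : f ∈ piecewiseQuasiPoly (V × ℤ)) :
    (fun x : V × ℤ => ∑ y ∈ Finset.Ico 0 x.2, f (x.1, y)) ∈ piecewiseQuasiPoly (V × ℤ) := by
  have key : ∀ h ∈ Submodule.span ℝ (rayTerms V),
      (fun x : V × ℤ => ∑ y ∈ Finset.Ico 0 x.2, h (x.1, y)) ∈ piecewiseQuasiPoly (V × ℤ) := by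
    intro h hh
    induction hh using Submodule.span_induction with
    | mem h hh => exact sum_Ico_rayTerm_mem hh
    | zero =>
      simp only [Pi.zero_apply, Finset.sum_const_zero]
      exact zero_mem _
    | add f g _ _ hf hg =>
      simp only [Pi.add_apply, Finset.sum_add_distrib]
      exact add_mem hf hg
    | smul r f _ hf =>
      simp only [Pi.smul_apply, ← Finset.smul_sum]
      exact Subalgebra.smul_mem _ hf r
  convert key _ (mul_nonneg_mem_span_rayTerms hf) using 2 with x
  refine Finset.sum_congr rfl fun y hy => ?_
  have : ¬ y < 0 := not_lt.2 (Finset.mem_Ico.1 hy).1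
  simp [rayIndicator, Set.indicator, this]

lemma sum_Icc_mem_piecewiseQuasiPoly {f : V × ℤ → ℝ} (hf : f ∈ piecewiseQuasiPoly (V × ℤ))
    (τ : V →+ ℤ) :
    (fun v => ∑ y ∈ Finset.Icc 0 (τ v), f (v, y)) ∈ piecewiseQuasiPoly V := by
  classical
  have h1 := piecewiseQuasiPoly.comp_mem (sum_Ico_mem_piecewiseQuasiPoly hf)
    ((AddMonoidHom.id V).prod τ)
  have h2 := mul_mem (IsPiecewiseSet.le 0 τ)
    (piecewiseQuasiPoly.comp_mem hf ((AddMonoidHom.id V).prod τ))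
  convert add_mem h1 h2 using 1
  ext v
  simp only [Function.comp_apply, Pi.add_apply, Pi.mul_apply, AddMonoidHom.prod_apply,
    AddMonoidHom.id_apply, AddMonoidHom.zero_apply, Set.indicator_apply, Set.mem_ofPred_eq,
    Pi.one_apply, ite_mul, one_mul, zero_mul]
  by_cases h : 0 ≤ τ v
  · rw [if_pos h, ← Finset.Ico_insert_right h, Finset.sum_insert (by simp), add_comm]
  · rw [if_neg h, Finset.Icc_eq_empty h, Finset.Ico_eq_empty_of_le (not_le.1 h).le]
    simp

end

lemma sum_piFinset_fin_mem_piecewiseQuasiPoly (n : ℕ) :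
    ∀ {V : Type} [AddCommGroup V] {f : V × (Fin n → ℤ) → ℝ}
      (_ : f ∈ piecewiseQuasiPoly (V × (Fin n → ℤ))) (τ : V →+ ℤ),
      (fun v => ∑ w ∈ Fintype.piFinset fun _ => Finset.Icc 0 (τ v), f (v, w)) ∈
        piecewiseQuasiPoly V := by
  induction n with
  | zero =>
    intro V _ f hf τ
    convert piecewiseQuasiPoly.comp_mem hf (AddMonoidHom.inl V (Fin 0 → ℤ)) using 1
    ext v
    simp only [Function.comp_apply, AddMonoidHom.inl_apply]
    rw [Finset.sum_eq_single 0]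
    · intro b _ hb
      exact absurd (Subsingleton.elim b 0) hb
    · intro h
      exact absurd (Fintype.mem_piFinset.2 fun i => i.elim0) h
  | succ n ih =>
    intro V _ f hf τ
    let L : (V × ℤ) × (Fin n → ℤ) →+ V × (Fin (n + 1) → ℤ) :=
      { toFun := fun x => (x.1.1, Fin.cons x.1.2 x.2)
        map_zero' := by
          ext i
          · rfl
          · refine Fin.cases ?_ (fun i => ?_) i <;> simp
        map_add' := fun x y => by
          ext i
          · rfl
          · refine Fin.cases ?_ (fun i => ?_) i <;> simp }
    have h := sum_Icc_mem_piecewiseQuasiPoly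
      (ih (piecewiseQuasiPoly.comp_mem hf L) (τ.comp (AddMonoidHom.fst V ℤ))) τ
    convert h using 1
    ext v
    change _ = ∑ y ∈ Finset.Icc 0 (τ v), ∑ w ∈ Fintype.piFinset fun _ => Finset.Icc 0 (τ v),
      f (L ((v, y), w))
    rw [← Finset.sum_product']
    refine Finset.sum_bij' (fun w _ => (w 0, Fin.tail w)) (fun x _ => Fin.cons x.1 x.2)
      ?_ ?_ ?_ ?_ ?_
    · intro w hw
      rw [Fintype.mem_piFinset] at hw
      exact Finset.mem_product.2 ⟨hw 0, Fintype.mem_piFinset.2 fun i => hw i.succ⟩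
    · intro x hx
      rw [Finset.mem_product, Fintype.mem_piFinset] at hx
      refine Fintype.mem_piFinset.2 fun i => ?_
      refine Fin.cases ?_ (fun i => ?_) i
      · exact hx.1
      · simpa using hx.2 i
    · intro w _
      exact Fin.cons_self_tail w
    · intro x _
      simp
    · intro w _
      simp [L]

lemma sum_piFinset_mem_piecewiseQuasiPoly {V ι : Type} [AddCommGroup V] [Fintype ι]
    [DecidableEq ι] {f : V × (ι → ℤ) → ℝ} (hf : f ∈ piecewiseQuasiPoly (V × (ι → ℤ)))
    (τ : V →+ ℤ) :
    (fun v => ∑ w ∈ Fintype.piFinset fun _ => Finset.Icc 0 (τ v), f (v, w)) ∈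
      piecewiseQuasiPoly V := by
  let e := Fintype.equivFin ι
  let L : V × (Fin (Fintype.card ι) → ℤ) →+ V × (ι → ℤ) :=
    { toFun := fun x => (x.1, x.2 ∘ e)
      map_zero' := rfl
      map_add' := fun _ _ => rfl }
  convert sum_piFinset_fin_mem_piecewiseQuasiPoly _ (piecewiseQuasiPoly.comp_mem hf L) τ using 1
  ext v
  refine Finset.sum_bij' (fun w _ => w ∘ e.symm) (fun w _ => w ∘ e) ?_ ?_ ?_ ?_ ?_
  · intro w hw
    exact Fintype.mem_piFinset.2 fun i => Fintype.mem_piFinset.1 hw _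
  · intro w hw
    exact Fintype.mem_piFinset.2 fun i => Fintype.mem_piFinset.1 hw _
  · intro w _
    ext i
    simp
  · intro w _
    ext i
    simp
  · intro w _
    simp only [L, Function.comp_apply, AddMonoidHom.coe_mk, ZeroHom.coe_mk]
    congr 2
    ext i
    simp

lemma exists_isQuasiPoly_of_mem {f : ℤ → ℝ} (hf : f ∈ piecewiseQuasiPoly ℤ) :
    ∃ q, IsQuasiPoly q ∧ ∀ n > 0, f n = q n := by
  have hlin (ℓ : ℤ →+ ℤ) (n : ℤ) : ℓ n = ℓ 1 * n := by
    have := map_zsmul ℓ n 1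
    simpa [mul_comm] using this
  induction hf using Algebra.adjoin_induction with
  | mem f hf =>
    rcases hf with (⟨ℓ, rfl⟩ | ⟨ℓ, φ, M, hM, hφ, rfl⟩) | ⟨ℓ, rfl⟩
    · refine ⟨_, IsQuasiPoly.intCast.comp_affine (ℓ 1) 0, fun n _ => ?_⟩
      simp [hlin ℓ n]
    · refine ⟨_, (IsQuasiPoly.of_periodic hM hφ).comp_affine (ℓ 1) 0, fun n _ => ?_⟩
      simp [hlin ℓ n]
    · by_cases h : 0 < ℓ 1
      · exact ⟨_, IsQuasiPoly.const 1, fun n hn => by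
          simp [Set.indicator, hlin ℓ n, mul_pos h hn]⟩
      · refine ⟨_, IsQuasiPoly.const 0, fun n hn => ?_⟩
        have : ¬ 0 < ℓ n := by
          rw [hlin ℓ n]
          exact not_lt.2 (mul_nonpos_of_nonpos_of_nonneg (not_lt.1 h) hn.le)
        simp [Set.indicator, this]
  | algebraMap r => exact ⟨_, IsQuasiPoly.const r, fun _ _ => rfl⟩
  | add f g _ _ hf hg =>
    obtain ⟨q, hq, hfq⟩ := hf
    obtain ⟨r, hr, hgr⟩ := hg
    exact ⟨_, hq.add hr, fun n hn => by simp [hfq n hn, hgr n hn]⟩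
  | mul f g _ _ hf hg =>
    obtain ⟨q, hq, hfq⟩ := hf
    obtain ⟨r, hr, hgr⟩ := hg
    exact ⟨_, hq.mul hr, fun n hn => by simp [hfq n hn, hgr n hn]⟩

lemma isSymmetricNS_and_genus_iff {H : Set ℕ} (hH : IsNumericalSemigroup H) (g : ℕ) :
    IsSymmetricNS H ∧ genus H = g ↔
      (∀ x, 2 * g ≤ x → x ∈ H) ∧ ∀ x y, x + y + 1 = 2 * g → (x ∈ H ↔ y ∉ H) := by
  classical
  obtain ⟨h0, hadd, hfin⟩ := hH
  set S : Set ℤ := insert (-1) ((fun n : ℕ => (n : ℤ)) '' Hᶜ) with hS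
  have hSfin : S.Finite := (hfin.image _).insert _
  set G := (Finset.range (2 * g)).filter (· ∉ H) with hG
  set N := (Finset.range (2 * g)).filter (· ∈ H) with hN
  have hGN : N.card + G.card = 2 * g := by
    rw [hG, hN, Finset.card_filter_add_card_filter_not, Finset.card_range]
  have hcompl (h : ∀ x, 2 * g ≤ x → x ∈ H) : Hᶜ = (G : Set ℕ) := by
    ext x
    simp only [Set.mem_compl_iff, hG, Finset.coe_filter, Finset.mem_range, Set.mem_ofPred_eq]
    exact ⟨fun hx => ⟨not_le.1 fun h' => hx (h x h'), hx⟩, fun hx => hx.2⟩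
  constructor
  · rintro ⟨hsym, hg⟩
    have hF : frobNum H = 2 * g - 1 := by
      rw [IsSymmetricNS, hg] at hsym
      linarith
    have hbig : ∀ x, 2 * g ≤ x → x ∈ H := fun x hx => by
      by_contra hxH
      have : (x : ℤ) ≤ frobNum H :=
        le_csSup hSfin.bddAbove (Or.inr ⟨x, hxH, rfl⟩)
      omega
    have hmem : frobNum H ∈ S := (Set.insert_nonempty _ _).csSup_mem hSfin
    have hno : ∀ x y, x + y + 1 = 2 * g → x ∈ H → y ∉ H := fun x y hxy hx hy => by
      rcases hmem with h | ⟨n, hn, h⟩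
      · omega
      · have : n = x + y := by
          simp only at h
          omega
        exact hn (this ▸ hadd x hx y hy)
    have hGcard : G.card = g := by
      rw [← hg, genus, hcompl hbig, Set.ncard_coe_finset]
    have himage : N.image (fun x => 2 * g - 1 - x) = G := by
      refine Finset.eq_of_subset_of_card_le (fun y hy => ?_) ?_
      · obtain ⟨x, hx, rfl⟩ := Finset.mem_image.1 hy
        obtain ⟨hx1, hx2⟩ := Finset.mem_filter.1 hx
        rw [Finset.mem_range] at hx1
        exact Finset.mem_filter.2 ⟨Finset.mem_range.2 (by omega), hno x _ (by omega) hx2⟩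
      · rw [Finset.card_image_of_injOn]
        · omega
        · intro x hx y hy hxy
          have hx1 := Finset.mem_range.1 (Finset.mem_filter.1 hx).1
          have hy1 := Finset.mem_range.1 (Finset.mem_filter.1 hy).1
          simp only at hxy
          omega
    refine ⟨hbig, fun x y hxy => ⟨hno x y hxy, fun hy => ?_⟩⟩
    have hyG : y ∈ G := Finset.mem_filter.2 ⟨Finset.mem_range.2 (by omega), hy⟩
    rw [← himage] at hyG
    obtain ⟨z, hz, hzy⟩ := Finset.mem_image.1 hyG
    obtain ⟨hz1, hz2⟩ := Finset.mem_filter.1 hz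
    rw [Finset.mem_range] at hz1
    have : z = x := by omega
    exact this ▸ hz2
  · rintro ⟨hbig, hsym⟩
    have hcard : N.card = G.card := by
      refine Finset.card_nbij' (fun x => 2 * g - 1 - x) (fun x => 2 * g - 1 - x) ?_ ?_ ?_ ?_
      · intro x hx
        obtain ⟨hx1, hx2⟩ := Finset.mem_filter.1 hx
        rw [Finset.mem_range] at hx1
        exact Finset.mem_filter.2
          ⟨Finset.mem_range.2 (by lia), (hsym x (2 * g - 1 - x) (by omega)).1 hx2⟩
      · intro x hx
        obtain ⟨hx1, hx2⟩ := Finset.mem_filter.1 hx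
        rw [Finset.mem_range] at hx1
        exact Finset.mem_filter.2
          ⟨Finset.mem_range.2 (by lia), (hsym (2 * g - 1 - x) x (by omega)).2 hx2⟩
      · intro x hx
        have hx1 := Finset.mem_range.1 (Finset.mem_filter.1 hx).1
        simp only
        omega
      · intro x hx
        have hx1 := Finset.mem_range.1 (Finset.mem_filter.1 hx).1
        simp only
        omega
    have hgenus : genus H = g := by
      rw [genus, hcompl hbig, Set.ncard_coe_finset]
      omega
    have hF : frobNum H = 2 * g - 1 := by
      refine IsGreatest.csSup_eq ⟨?_, ?_⟩
      · rcases Nat.eq_zero_or_pos g with rfl | hg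
        · exact Or.inl (by simp)
        · refine Or.inr ⟨2 * g - 1, fun h => (hsym (2 * g - 1) 0 (by omega)).1 h h0, ?_⟩
          simp only
          omega
      · rintro _ (rfl | ⟨n, hn, rfl⟩)
        · omega
        · have : ¬ 2 * g ≤ n := fun h => hn (hbig n h)
          simp only
          omega
    exact ⟨by rw [IsSymmetricNS, hF, hgenus]; ring, hgenus⟩

/-- The functions giving the least element in each residue class modulo `p` of a symmetric
numerical semigroup which contains `p` and has Frobenius number `T - p`. -/
def IsSymmetricApery (p : ℕ) (T : ℤ) (w : ZMod p → ℤ) : Prop :=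
  w 0 = 0 ∧ (∀ a, 0 ≤ w a) ∧ (∀ a, (w a : ZMod p) = a) ∧ (∀ a b, w (a + b) ≤ w a + w b) ∧
    ∀ a b, (T : ZMod p) = a + b → w a + w b = T

lemma IsSymmetricApery.le {p : ℕ} {T : ℤ} {w : ZMod p → ℤ} (hw : IsSymmetricApery p T w)
    (a : ZMod p) : w a ≤ T := by
  have h1 := hw.2.2.2.2 a (T - a) (by ring)
  have h2 := hw.2.1 (T - a)
  linarith

lemma exists_eq_add_mul_of_intCast_eq {p : ℕ} {x y : ℤ} (h : (x : ZMod p) = y) :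
    ∃ k, x = y + p * k := by
  obtain ⟨k, hk⟩ := (ZMod.intCast_eq_intCast_iff_dvd_sub y x p).1 h.symm
  exact ⟨k, by linarith⟩

lemma add_le_of_intCast_eq_of_lt {p : ℕ} {x y : ℤ} (h : (x : ZMod p) = y) (hlt : y < x) :
    y + p ≤ x := by
  obtain ⟨k, hk⟩ := exists_eq_add_mul_of_intCast_eq h
  have : 0 < k := by
    by_contra! h
    have : (p : ℤ) * k ≤ 0 := mul_nonpos_of_nonneg_of_nonpos (by positivity) h
    omega
  nlinarith

/-- The subset of `ℕ` whose least elements modulo `p` are given by `w`. -/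
def semigroupOfApery (p : ℕ) (w : ZMod p → ℤ) : Set ℕ := {n | w n ≤ n}

lemma injOn_semigroupOfApery (p : ℕ) (T : ℤ) :
    Set.InjOn (semigroupOfApery p) {w | IsSymmetricApery p T w} := by
  have key : ∀ w w' : ZMod p → ℤ, IsSymmetricApery p T w →
      semigroupOfApery p w = semigroupOfApery p w' → ∀ a, w' a ≤ w a := by
    intro w w' hw h a
    obtain ⟨n, hn⟩ := Int.eq_ofNat_of_zero_le (hw.2.1 a)
    have hna : (n : ZMod p) = a := by
      have := hw.2.2.1 a
      rwa [hn, Int.cast_natCast] at this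
    have hmem : n ∈ semigroupOfApery p w := by
      change w n ≤ n
      rw [hna, hn]
    rw [h] at hmem
    change w' n ≤ n at hmem
    rwa [hna, ← hn] at hmem
  intro w hw w' hw' h
  ext a
  exact le_antisymm (key w' w hw' h.symm a) (key w w' hw h a)

lemma IsSymmetricApery.isNumericalSemigroup {p : ℕ} {T : ℤ} {w : ZMod p → ℤ}
    (hw : IsSymmetricApery p T w) : IsNumericalSemigroup (semigroupOfApery p w) := by
  refine ⟨?_, fun a ha b hb => ?_, ?_⟩
  · simp [semigroupOfApery, hw.1]
  · have := hw.2.2.2.1 a b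
    simp only [semigroupOfApery, Set.mem_ofPred_eq] at ha hb ⊢
    push_cast
    linarith
  · refine (Set.finite_Iio T.toNat).subset fun n hn => ?_
    have h1 : ¬ w n ≤ n := hn
    have h2 := hw.le n
    rw [Set.mem_Iio]
    omega

lemma IsSymmetricApery.symmetric {p g : ℕ} (hp : 0 < p) {w : ZMod p → ℤ}
    (hw : IsSymmetricApery p (2 * g - 1 + p) w) :
    (∀ x, 2 * g ≤ x → x ∈ semigroupOfApery p w) ∧
      ∀ x y, x + y + 1 = 2 * g → (x ∈ semigroupOfApery p w ↔ y ∉ semigroupOfApery p w) := by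
  have hstep (y : ℕ) (hy : ¬ w y ≤ y) : y + p ≤ w y :=
    add_le_of_intCast_eq_of_lt (by rw [hw.2.2.1, Int.cast_natCast]) (not_le.1 hy)
  refine ⟨fun x hx => ?_, fun x y hxy => ?_⟩
  · by_contra h
    have h1 := hstep x h
    have h2 := hw.le x
    omega
  · have hT := hw.2.2.2.2 x y (by
      have : (2 * g - 1 + p : ℤ) = x + y + p := by omega
      rw [this]
      simp)
    change w x ≤ x ↔ ¬ w y ≤ y
    constructor
    · intro h1 h2
      omega
    · intro h
      have := hstep y h
      omega

lemma exists_isSymmetricApery {p g : ℕ} (hp : 0 < p) {H : Set ℕ} (hH : IsNumericalSemigroup H)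
    (hpH : p ∈ H) (hbig : ∀ x, 2 * g ≤ x → x ∈ H)
    (hsym : ∀ x y, x + y + 1 = 2 * g → (x ∈ H ↔ y ∉ H)) :
    ∃ w, IsSymmetricApery p (2 * g - 1 + p) w ∧ semigroupOfApery p w = H := by
  classical
  have : NeZero p := ⟨hp.ne'⟩
  obtain ⟨h0, hadd, -⟩ := hH
  have hex (a : ZMod p) : ∃ n, n ∈ H ∧ (n : ZMod p) = a :=
    ⟨a.val + p * (2 * g), hbig _ (by nlinarith), by simp⟩
  let u : ZMod p → ℕ := fun a => Nat.find (hex a)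
  have huH (a) : u a ∈ H := (Nat.find_spec (hex a)).1
  have hua (a) : (u a : ZMod p) = a := (Nat.find_spec (hex a)).2
  have hmin (n : ℕ) (hn : n ∈ H) : u n ≤ n := Nat.find_min' (hex n) ⟨hn, rfl⟩
  have hmul (k : ℕ) : p * k ∈ H := by
    induction k with
    | zero => simpa using h0
    | succ k ih => exact hadd _ ih _ hpH
  have hup (n : ℕ) (hn : u n ≤ n) : n ∈ H := by
    have : n ≡ u n [MOD p] := by
      rw [← ZMod.natCast_eq_natCast_iff, hua]
    obtain ⟨k, hk⟩ := (Nat.modEq_iff_dvd' hn).1 this.symm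
    have : n = u n + p * k := by omega
    rw [this]
    exact hadd _ (huH _) _ (hmul k)
  refine ⟨fun a => u a, ⟨?_, fun a => by positivity, fun a => by simp [hua], ?_, ?_⟩, ?_⟩
  · have := hmin 0 h0
    simp only [Nat.cast_zero] at this
    simp only
    omega
  · intro a b
    have := hmin _ (hadd _ (huH a) _ (huH b))
    rw [Nat.cast_add, hua, hua] at this
    simp only
    exact_mod_cast this
  · intro a b hab
    have hcast : ((u a + u b : ℤ) : ZMod p) = ((2 * g - 1 + p : ℤ) : ZMod p) := by
      rw [hab]
      simp [hua]
    have hab' : (2 * g - 1 : ZMod p) = a + b := by simpa using hab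
    rcases lt_trichotomy (u a + u b : ℤ) (2 * g - 1 + p) with h | h | h
    · exfalso
      have h1 := add_le_of_intCast_eq_of_lt hcast.symm h
      obtain ⟨y, hy⟩ : ∃ y, u a + y + 1 = 2 * g := ⟨2 * g - 1 - u a, by omega⟩
      refine (hsym _ y hy).1 (huH a) (hup y ?_)
      have : (y : ZMod p) = b := by
        have h2 : (y : ZMod p) = ((2 * g - 1 - u a : ℤ) : ZMod p) := by
          rw [← Int.cast_natCast]
          congr 1
          omega
        rw [h2]
        push_cast
        rw [hua, hab']
        ring
      rw [this]
      omega
    · exact h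
    · exfalso
      have h1 := add_le_of_intCast_eq_of_lt hcast h
      have hsub (c : ZMod p) (hc : p ≤ u c) : u c - p ∉ H := fun hmem => by
        have := hmin _ hmem
        rw [Nat.cast_sub hc, hua, ZMod.natCast_self, sub_zero] at this
        omega
      by_cases ha : p ≤ u a
      · have hx := hsub a ha
        by_cases hx' : 2 * g ≤ u a - p
        · exact hx (hbig _ hx')
        · obtain ⟨y, hy⟩ : ∃ y, (u a - p) + y + 1 = 2 * g := ⟨2 * g - 1 - (u a - p), by omega⟩
          have hyH : y ∈ H := not_not.1 fun h => hx ((hsym _ _ hy).2 h)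
          have : (y : ZMod p) = b := by
            have h2 : (y : ZMod p) = ((2 * g - 1 - u a + p : ℤ) : ZMod p) := by
              rw [← Int.cast_natCast]
              congr 1
              omega
            rw [h2]
            push_cast
            rw [hua, hab', ZMod.natCast_self]
            ring
          have h3 := hmin y hyH
          rw [this] at h3
          omega
      · exact hsub b (by omega) (hbig _ (by omega))
  · ext n
    change ((u n : ℤ) ≤ n) ↔ n ∈ H
    rw [Nat.cast_le]
    exact ⟨hup n, hmin n⟩

lemma countGenusSym_eq_ncard {p : ℕ} (hp : 0 < p) (g : ℕ) :
    countGenusSym p g = {w | IsSymmetricApery p (2 * g - 1 + p) w}.ncard := by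
  rw [countGenusSym, ← (injOn_semigroupOfApery p _).ncard_image]
  congr 1
  ext H
  constructor
  · rintro ⟨hH, hpH, hs⟩
    obtain ⟨hbig, hsym⟩ := (isSymmetricNS_and_genus_iff hH g).1 hs
    exact exists_isSymmetricApery hp hH hpH hbig hsym
  · rintro ⟨w, hw, rfl⟩
    refine ⟨hw.isNumericalSemigroup, ?_,
      (isSymmetricNS_and_genus_iff hw.isNumericalSemigroup g).2 (hw.symmetric hp)⟩
    change w p ≤ p
    rw [ZMod.natCast_self, hw.1]
    positivity

lemma isPiecewiseSet_isSymmetricApery (p : ℕ) [NeZero p] :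
    IsPiecewiseSet {x : ℤ × (ZMod p → ℤ) | IsSymmetricApery p x.1 x.2} := by
  let τ : ℤ × (ZMod p → ℤ) →+ ℤ := AddMonoidHom.fst _ _
  let ω (a : ZMod p) : ℤ × (ZMod p → ℤ) →+ ℤ :=
    (Pi.evalAddMonoidHom (fun _ => ℤ) a).comp (AddMonoidHom.snd _ _)
  have hmod (ℓ : ℤ × (ZMod p → ℤ) →+ ℤ) (a : ZMod p) : IsPiecewiseSet {x | (ℓ x : ZMod p) = a} :=
    IsPiecewiseSet.periodic ℓ (A := {n | (n : ZMod p) = a}) (M := p)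
      (by exact_mod_cast NeZero.pos p) (by simp)
  exact (IsPiecewiseSet.eq (ω 0) 0).inter <|
    (IsPiecewiseSet.forall_finite fun a => IsPiecewiseSet.le 0 (ω a)).inter <|
    (IsPiecewiseSet.forall_finite fun a => hmod (ω a) a).inter <|
    (IsPiecewiseSet.forall_finite fun a => IsPiecewiseSet.forall_finite fun b =>
      IsPiecewiseSet.le (ω (a + b)) (ω a + ω b)).inter <|
    IsPiecewiseSet.forall_finite fun a => IsPiecewiseSet.forall_finite fun b =>
      (hmod τ (a + b)).imp (IsPiecewiseSet.eq (ω a + ω b) τ)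

lemma exists_isQuasiPoly_countGenusSym {p : ℕ} (hp : 2 ≤ p) :
    ∃ q, IsQuasiPoly q ∧ ∀ g : ℕ, (countGenusSym p g : ℝ) = q g := by
  classical
  have : NeZero p := ⟨by omega⟩
  obtain ⟨q, hq, hqf⟩ := exists_isQuasiPoly_of_mem
    (sum_piFinset_mem_piecewiseQuasiPoly (isPiecewiseSet_isSymmetricApery p) (AddMonoidHom.id ℤ))
  refine ⟨_, hq.comp_affine 2 (p - 1), fun g => ?_⟩
  rw [← hqf _ (by omega), countGenusSym_eq_ncard (by omega)]
  have hT : (2 * g + (p - 1) : ℤ) = 2 * g - 1 + p := by ring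
  rw [hT]
  generalize (2 * g - 1 + p : ℤ) = T
  have hset : {w | IsSymmetricApery p T w} =
      ((Fintype.piFinset fun _ : ZMod p => Finset.Icc 0 T).filter (IsSymmetricApery p T) :
        Finset (ZMod p → ℤ)) := by
    ext w
    simp only [Set.mem_ofPred_eq, Finset.coe_filter, Fintype.mem_piFinset, Finset.mem_Icc]
    exact ⟨fun h => ⟨fun a => ⟨h.2.1 a, h.le a⟩, h⟩, fun h => h.2⟩
  rw [hset, Set.ncard_coe_finset, Finset.card_filter]
  push_cast
  simp [Set.indicator_apply]

lemma IsQuasiPoly.exists_nat {q : ℤ → ℝ} (hq : IsQuasiPoly q) :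
    ∃ (N : ℕ) (c : ℕ → ℝ[X]), 0 < N ∧ ∀ n : ℕ, q n = (c (n % N)).eval (n : ℝ) := by
  obtain ⟨M, c, hM, hc, h⟩ := hq
  lift M to ℕ using hM.le
  refine ⟨M, fun n => c n, by exact_mod_cast hM, fun n => ?_⟩
  have := hc.int_mul (n / M) (n % M)
  rw [Int.cast_id, mul_comm, Int.emod_add_mul_ediv] at this
  simp [h, this]

lemma Polynomial.degree_le_of_abs_eval_le {P Q : ℝ[X]} {u : ℕ → ℝ}
    (hu : Filter.Tendsto u Filter.atTop Filter.atTop)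
    (h : ∀ k, |P.eval (u k)| ≤ |Q.eval (u k)|) : P.degree ≤ Q.degree := by
  by_contra! hlt
  have hP : P ≠ 0 := fun h => by simp [h] at hlt
  have hlim := hu.eventually
    ((Q.div_tendsto_atTop_zero_of_degree_lt P hlt).eventually (Metric.ball_mem_nhds 0 one_pos))
  obtain ⟨k, hk1, hk2⟩ := (hlim.and (hu.eventually (P.eventually_atTop_not_isRoot hP))).exists
  rw [dist_zero_right, Real.norm_eq_abs, abs_div, div_lt_one (abs_pos.2 hk2)] at hk1
  exact absurd (h k) (not_le.2 hk1)

/-- One representative of each pair `{a, f - a}` of distinct elements of `ZMod p` other than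
`{0, f}`. -/
def pairRepresentatives (p : ℕ) [NeZero p] (f : ZMod p) : Finset (ZMod p) :=
  {a | a ≠ 0 ∧ a ≠ f ∧ a.val < (f - a).val}

lemma two_mul_card_pairRepresentatives_le {p : ℕ} [NeZero p] {f : ZMod p} (hf : f ≠ 0) :
    2 * (pairRepresentatives p f).card + 2 ≤ p := by
  set R := pairRepresentatives p f with hR
  have hmem (a) : a ∈ R ↔ a ≠ 0 ∧ a ≠ f ∧ a.val < (f - a).val := by simp [hR, pairRepresentatives]
  have h1 : Disjoint R (R.image (f - ·)) := by
    rw [Finset.disjoint_left]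
    intro a ha ha'
    obtain ⟨b, hb, rfl⟩ := Finset.mem_image.1 ha'
    have h2 := ((hmem _).1 ha).2.2
    have h3 := ((hmem _).1 hb).2.2
    rw [sub_sub_cancel] at h2
    exact lt_asymm h2 h3
  have h2 : Disjoint (R ∪ R.image (f - ·)) {0, f} := by
    rw [Finset.disjoint_left]
    intro a ha ha'
    rw [Finset.mem_insert, Finset.mem_singleton] at ha'
    rcases Finset.mem_union.1 ha with h | h
    · have := (hmem _).1 h
      tauto
    · obtain ⟨b, hb, rfl⟩ := Finset.mem_image.1 h
      have := (hmem _).1 hb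
      rcases ha' with h | h
      · exact this.2.1 (sub_eq_zero.1 h).symm
      · exact this.1 (by simpa using h)
  have h3 := Finset.card_le_univ (R ∪ R.image (f - ·) ∪ {0, f})
  rw [Finset.card_union_of_disjoint h2, Finset.card_union_of_disjoint h1,
    Finset.card_image_of_injective _ sub_right_injective, Finset.card_pair hf.symm, ZMod.card] at h3
  omega

lemma injOn_restrict_isSymmetricApery (p : ℕ) [NeZero p] (T : ℤ) :
    Set.InjOn (fun (w : ZMod p → ℤ) (a : pairRepresentatives p T) => w a)
      {w | IsSymmetricApery p T w} := by
  intro w hw w' hw' h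
  have hR (a : ZMod p) (ha : a ∈ pairRepresentatives p T) : w a = w' a := congrFun h ⟨a, ha⟩
  simp only [pairRepresentatives, Finset.mem_filter, Finset.mem_univ, true_and] at hR
  ext a
  have h1 := hw.2.2.2.2 a (T - a) (by ring)
  have h2 := hw'.2.2.2.2 a (T - a) (by ring)
  by_cases ha0 : a = 0
  · rw [ha0, hw.1, hw'.1]
  by_cases haf : a = T
  · rw [haf, sub_self, hw.1] at h1
    rw [haf, sub_self, hw'.1] at h2
    rw [haf]
    linarith
  rcases lt_trichotomy a.val (T - a : ZMod p).val with hlt | heq | hgt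
  · exact hR a ⟨ha0, haf, hlt⟩
  · rw [← ZMod.val_injective p heq] at h1 h2
    linarith
  · have := hR (T - a) ⟨sub_ne_zero.2 (Ne.symm haf), by simpa using ha0, by simpa using hgt⟩
    linarith

lemma finite_isSymmetricApery (p : ℕ) [NeZero p] (T : ℤ) :
    {w | IsSymmetricApery p T w}.Finite :=
  (Set.finite_Icc (0 : ZMod p → ℤ) fun _ => T).subset fun _ h => ⟨h.2.1, h.le⟩

lemma ncard_isSymmetricApery_le (p : ℕ) [NeZero p] {T : ℕ} (hT : 0 < T) :
    {w | IsSymmetricApery p T w}.ncard ≤ (T + 1) ^ (p / 2 - 1) := by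
  by_cases hf : ((T : ℤ) : ZMod p) = 0
  · have : {w | IsSymmetricApery p T w} = ∅ := by
      refine Set.eq_empty_of_forall_notMem fun w hw => ?_
      have := hw.2.2.2.2 0 0 (by simpa using hf)
      rw [hw.1] at this
      omega
    simp [this]
  · calc {w | IsSymmetricApery p T w}.ncard
        ≤ ((Fintype.piFinset fun _ : pairRepresentatives p (T : ℤ) => Finset.Icc (0 : ℤ) T :
            Finset _) : Set _).ncard :=
          Set.ncard_le_ncard_of_injOn _
            (fun w hw => by
              rw [Finset.mem_coe, Fintype.mem_piFinset]
              exact fun a => Finset.mem_Icc.2 ⟨hw.2.1 a, hw.le a⟩)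
            (injOn_restrict_isSymmetricApery p T) (Finset.finite_toSet _)
      _ = (T + 1) ^ (pairRepresentatives p (T : ℤ)).card := by
          rw [Set.ncard_coe_finset, Fintype.card_piFinset, Finset.prod_const, Int.card_Icc,
            Finset.card_univ, Fintype.card_coe]
          congr 1
      _ ≤ (T + 1) ^ (p / 2 - 1) := by
          have := two_mul_card_pairRepresentatives_le hf
          exact Nat.pow_le_pow_right (by omega) (by omega)

lemma val_add_val_of_add_eq_neg_one {p : ℕ} [NeZero p] {a b : ZMod p} (hab : a + b = -1) :
    (a.val + b.val : ℤ) = p - 1 := by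
  have hp := NeZero.pos p
  obtain ⟨q, rfl⟩ : ∃ q, p = q + 1 := ⟨p - 1, by omega⟩
  have h1 : (a + b).val = q := by rw [hab, ZMod.val_neg_one]
  have h2 := a.val_lt
  have h3 := b.val_lt
  rw [ZMod.val_add] at h1
  rcases lt_or_ge (a.val + b.val) (q + 1) with h4 | h4
  · rw [Nat.mod_eq_of_lt h4] at h1
    push_cast
    omega
  · rw [Nat.mod_eq_sub_mod h4, Nat.mod_eq_of_lt (by omega)] at h1
    omega

lemma isSymmetricApery_val_add_mul {p : ℕ} [NeZero p] {K : ℤ} {h : ZMod p → ℤ} (h0 : h 0 = 0)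
    (hnonneg : ∀ a, 0 ≤ h a) (hle : ∀ a b, a + b ≠ -1 → h (a + b) ≤ h a + h b)
    (hsymm : ∀ a b, a + b = -1 → h a + h b = K) :
    IsSymmetricApery p (p * K + p - 1) fun a => a.val + p * h a := by
  have hadd (a b : ZMod p) (hab : a + b = -1) :
      (a.val + p * h a : ℤ) + (b.val + p * h b) = p * K + p - 1 := by
    linear_combination val_add_val_of_add_eq_neg_one hab + p * hsymm a b hab
  refine ⟨by simp [h0], fun a => by have := hnonneg a; positivity, fun a => by simp, fun a b => ?_,
    fun a b hab => hadd a b (by simpa using hab.symm)⟩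
  by_cases hab : a + b = -1
  · rw [hadd a b hab, hab]
    have h1 := hsymm 0 (-1) (by simp)
    have h2 := val_add_val_of_add_eq_neg_one (p := p) (a := 0) (b := -1) (by simp)
    rw [h0] at h1
    rw [ZMod.val_zero] at h2
    push_cast at h2
    rw [← h1]
    linarith
  · have h1 := hle a b hab
    have h2 : ((a + b).val : ℤ) ≤ a.val + b.val := by exact_mod_cast ZMod.val_add_le a b
    have h3 : (p * h (a + b) : ℤ) ≤ p * (h a + h b) := by gcongr
    simp only
    linarith

/-- Large heights in the residue classes modulo `p`, symmetric under `n ↦ p - 1 - n`. -/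
def symmetricHeight (p m : ℕ) (e : Fin (p / 2 - 1) → Fin m) (n : ℕ) : ℤ :=
  if n = 0 then 0
  else if n = p - 1 then 6 * m
  else if h : n - 1 < p / 2 - 1 then 2 * m + 1 + (e ⟨n - 1, h⟩ : ℕ)
  else if h : p - 2 - n < p / 2 - 1 then 4 * m - 1 - (e ⟨p - 2 - n, h⟩ : ℕ)
  else 3 * m

lemma symmetricHeight_add {p m : ℕ} (hp : 2 ≤ p) (e : Fin (p / 2 - 1) → Fin m) {n k : ℕ}
    (h : n + k + 1 = p) : symmetricHeight p m e n + symmetricHeight p m e k = 6 * m := by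
  have hk : p - 2 - n = k - 1 := by omega
  have hn : p - 2 - k = n - 1 := by omega
  simp only [symmetricHeight, hk, hn]
  split_ifs <;> omega

lemma symmetricHeight_bounds {p m : ℕ} (e : Fin (p / 2 - 1) → Fin m) {n : ℕ} (h0 : n ≠ 0)
    (h1 : n ≠ p - 1) :
    2 * m ≤ symmetricHeight p m e n ∧ symmetricHeight p m e n ≤ 4 * m := by
  simp only [symmetricHeight, h0, h1, if_false]
  split_ifs <;> omega

lemma pow_le_ncard_isSymmetricApery {p : ℕ} (hp : 3 ≤ p) (m : ℕ) :
    m ^ (p / 2 - 1) ≤ {w | IsSymmetricApery p (p * (6 * m) + p - 1) w}.ncard := by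
  have : NeZero p := ⟨by omega⟩
  let φ (e : Fin (p / 2 - 1) → Fin m) (a : ZMod p) : ℤ := a.val + p * symmetricHeight p m e a.val
  have hneg : (-1 : ZMod p).val = p - 1 := by
    obtain ⟨q, rfl⟩ : ∃ q, p = q + 1 := ⟨p - 1, by omega⟩
    exact ZMod.val_neg_one q
  have hφ (e) : IsSymmetricApery p (p * (6 * m) + p - 1) (φ e) := by
    have h0 : symmetricHeight p m e (0 : ZMod p).val = 0 := by simp [symmetricHeight]
    have h1 : symmetricHeight p m e (-1 : ZMod p).val = 6 * m := by
      rw [hneg, symmetricHeight, if_neg (by omega), if_pos rfl]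
    have hb (a : ZMod p) (ha0 : a ≠ 0) (ha1 : a ≠ -1) :=
      symmetricHeight_bounds e (n := a.val) (by simpa using ha0)
        (by rw [← hneg]; exact fun h => ha1 (ZMod.val_injective p h))
    have hnonneg (a : ZMod p) : 0 ≤ symmetricHeight p m e a.val := by
      by_cases ha0 : a = 0
      · rw [ha0, h0]
      by_cases ha1 : a = -1
      · rw [ha1, h1]
        positivity
      have := hb a ha0 ha1
      omega
    have hge (a : ZMod p) (ha0 : a ≠ 0) : 2 * m ≤ symmetricHeight p m e a.val := by
      by_cases ha1 : a = -1
      · rw [ha1, h1]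
        omega
      · exact (hb a ha0 ha1).1
    refine isSymmetricApery_val_add_mul h0 hnonneg (fun a b hab => ?_) fun a b hab => ?_
    · by_cases ha : a = 0
      · simpa [ha] using hnonneg 0
      by_cases hb0 : b = 0
      · simpa [hb0] using hnonneg 0
      have h2 := hge a ha
      have h3 := hge b hb0
      by_cases hab0 : a + b = 0
      · rw [hab0, h0]
        omega
      have := hb _ hab0 hab
      omega
    · refine symmetricHeight_add (by omega) e ?_
      have h2 := val_add_val_of_add_eq_neg_one hab
      omega
  have hinj : Function.Injective φ := by
    intro e e' h
    ext i
    have hi := i.2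
    have hval : ((i + 1 : ℕ) : ZMod p).val = i + 1 := ZMod.val_cast_of_lt (by omega)
    have h2 := congrFun h ((i + 1 : ℕ) : ZMod p)
    simp only [φ, hval, add_right_inj] at h2
    have h3 := mul_left_cancel₀ (by exact_mod_cast NeZero.ne p) h2
    simp only [symmetricHeight, Nat.add_sub_cancel, Fin.eta, hi, dite_true] at h3
    rw [if_neg (by omega), if_neg (by omega), if_neg (by omega), if_neg (by omega)] at h3
    omega
  calc m ^ (p / 2 - 1) = (Set.range φ).ncard := by
        rw [← Set.image_univ, Set.ncard_image_of_injective _ hinj, Set.ncard_univ]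
        simp
    _ ≤ _ := Set.ncard_le_ncard (Set.range_subset_iff.2 hφ) (finite_isSymmetricApery p _)

/-- `g ↦ G_sym(p,g)` is a quasi-polynomial of degree `⌊p/2⌋ - 1`. -/
theorem countGenusSym_quasiPolynomial (p : ℕ) (hp : 3 ≤ p) :
    ∃ (N : ℕ) (c : ℕ → Polynomial ℝ), 0 < N ∧
      (∀ i < N, (c i).degree ≤ ((p / 2 - 1 : ℕ) : WithBot ℕ)) ∧
      (∃ i < N, (c i).degree = ((p / 2 - 1 : ℕ) : WithBot ℕ)) ∧
      (∀ g : ℕ, (countGenusSym p g : ℝ) = (c (g % N)).eval (g : ℝ)) := by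
  have : NeZero p := ⟨by omega⟩
  obtain ⟨q, hq, hcount⟩ := exists_isQuasiPoly_countGenusSym (p := p) (by omega)
  obtain ⟨N, c, hN, hc⟩ := hq.exists_nat
  have heval (i k : ℕ) (hi : i < N) :
      (c i).eval ((i + N * k : ℕ) : ℝ) = countGenusSym p (i + N * k) := by
    rw [hcount, hc, Nat.add_mul_mod_self_left, Nat.mod_eq_of_lt hi]
  have hupper (i : ℕ) (hi : i < N) : (c i).degree ≤ ((p / 2 - 1 : ℕ) : WithBot ℕ) := by
    have hdeg : ((C 2 * X + C (p : ℝ)) ^ (p / 2 - 1)).degree = ((p / 2 - 1 : ℕ) : WithBot ℕ) := by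
      rw [degree_pow, degree_linear two_ne_zero]
      simp
    rw [← hdeg]
    refine degree_le_of_abs_eval_le (u := fun k => ((i + N * k : ℕ) : ℝ)) ?_ fun k => ?_
    · refine tendsto_natCast_atTop_atTop.comp
        (Filter.tendsto_atTop_mono (f := id) (fun k => ?_) Filter.tendsto_id)
      simp only [id]
      nlinarith
    · rw [heval i k hi, countGenusSym_eq_ncard (by omega)]
      generalize i + N * k = g
      have hT : (2 * g - 1 + p : ℤ) = ((2 * g + (p - 1) : ℕ) : ℤ) := by omega
      have h1 := ncard_isSymmetricApery_le p (T := 2 * g + (p - 1)) (by omega)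
      have h2 : 2 * g + (p - 1) + 1 = 2 * g + p := by omega
      rw [h2] at h1
      rw [hT, abs_of_nonneg (by positivity)]
      refine le_trans ?_ (le_abs_self _)
      simp only [eval_pow, eval_add, eval_mul, eval_C, eval_X]
      exact_mod_cast h1
  refine ⟨N, c, hN, hupper, ⟨0, hN, (hupper 0 hN).antisymm ?_⟩, fun g => by rw [hcount, hc]⟩
  have hdeg : ((C ((3 * p * N : ℝ)⁻¹) * X) ^ (p / 2 - 1)).degree =
      ((p / 2 - 1 : ℕ) : WithBot ℕ) := by
    rw [degree_pow, degree_C_mul_X (by positivity)]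
    simp
  rw [← hdeg]
  refine degree_le_of_abs_eval_le (u := fun k => ((0 + N * (3 * p * k) : ℕ) : ℝ)) ?_ fun k => ?_
  · refine tendsto_natCast_atTop_atTop.comp
      (Filter.tendsto_atTop_mono (f := id) (fun k => ?_) Filter.tendsto_id)
    simp only [id, zero_add]
    nlinarith [Nat.mul_le_mul hN (show 1 ≤ 3 * p by omega), Nat.zero_le k]
  · rw [heval 0 _ hN, countGenusSym_eq_ncard (by omega)]
    have h1 := pow_le_ncard_isSymmetricApery hp (N * k)
    have hT : (2 * ((0 + N * (3 * p * k) : ℕ) : ℤ) - 1 + p : ℤ) =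
        p * (6 * ((N * k : ℕ) : ℤ)) + p - 1 := by
      push_cast
      ring
    have hX : (C ((3 * p * N : ℝ)⁻¹) * X : ℝ[X]).eval ((0 + N * (3 * p * k) : ℕ) : ℝ) = k := by
      simp only [eval_mul, eval_C, eval_X]
      push_cast
      have : (N : ℝ) ≠ 0 := by positivity
      have : (p : ℝ) ≠ 0 := by positivity
      field_simp
      ring
    rw [hT, eval_pow, hX, abs_of_nonneg (by positivity), abs_of_nonneg (by positivity)]
    have h2 : k ^ (p / 2 - 1) ≤ (N * k) ^ (p / 2 - 1) :=
      Nat.pow_le_pow_left (Nat.le_mul_of_pos_left k hN) _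
    exact_mod_cast h2.trans h1
end

section
/- Let f : ℕ → ℝ be a quasi-polynomial of degree d, represented by an integer N > 0 and polynomials f_0,…,f_{N−1} ∈ ℝ[T] of degree ≤ d (at least one of degree exactly d) with f(n) = f_i(n) whenever n ≡ i (mod N). If f is weakly increasing (f(n) ≤ f(n+1) for all n ∈ ℕ), then the coefficient of T^d is the same in all of the polynomials f_0,…,f_{N−1}. -/
open Filter Topology in
theorem Polynomial.tendsto_eval_div_pow_coeff {P : Polynomial ℝ} {d : ℕ}
    (h : P.degree ≤ (d : WithBot ℕ)) :
    Tendsto (fun x : ℝ => P.eval x / x ^ d) atTop (𝓝 (P.coeff d)) := by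
  rcases h.lt_or_eq with hlt | heq
  · have := P.div_tendsto_atTop_zero_of_degree_lt (Polynomial.X ^ d) (by simpa using hlt)
    simpa [Polynomial.coeff_eq_zero_of_degree_lt hlt] using this
  · have := P.div_tendsto_atTop_leadingCoeff_div_of_degree_eq (Polynomial.X ^ d)
      (by simpa using heq)
    simpa [Polynomial.leadingCoeff, Polynomial.natDegree_eq_of_degree_eq_some heq] using this

theorem Polynomial.coeff_taylor_of_degree_le {P : Polynomial ℝ} {d : ℕ}
    (h : P.degree ≤ (d : WithBot ℕ)) (r : ℝ) :
    (Polynomial.taylor r P).coeff d = P.coeff d := by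
  rcases h.lt_or_eq with hlt | heq
  · rw [Polynomial.coeff_eq_zero_of_degree_lt hlt,
      Polynomial.coeff_eq_zero_of_degree_lt (by rwa [Polynomial.degree_taylor])]
  · obtain rfl := Polynomial.natDegree_eq_of_degree_eq_some heq
    simp

/-- If a quasi-polynomial `f` of degree `d` (with constituent polynomials
`c 0, …, c (N-1)`) is weakly increasing, then the coefficient of `T^d` is the same
in all constituent polynomials. -/
theorem leadingCoeff_const_of_monotone
    (f : ℕ → ℝ) (d N : ℕ) (hN : 0 < N) (c : ℕ → Polynomial ℝ)
    (hdeg : ∀ i < N, (c i).degree ≤ (d : WithBot ℕ))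
    (hex : ∃ i < N, (c i).degree = (d : WithBot ℕ))
    (hrep : ∀ n : ℕ, f n = (c (n % N)).eval (n : ℝ))
    (hmono : ∀ n : ℕ, f n ≤ f (n + 1)) :
    ∀ i < N, ∀ j < N, (c i).coeff d = (c j).coeff d := by
  suffices key : ∀ i < N, ∀ j < N, (c i).coeff d ≤ (c j).coeff d from
    fun i hi j hj => le_antisymm (key i hi j hj) (key j hj i hi)
  intro i hi j hj
  have hx : Filter.Tendsto (fun k : ℕ => ((i + N * k : ℕ) : ℝ)) Filter.atTop Filter.atTop :=
    tendsto_natCast_atTop_atTop.comp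
      (Filter.tendsto_atTop_mono
        (fun k => (Nat.le_mul_of_pos_left k hN).trans (Nat.le_add_left _ i)) Filter.tendsto_id)
  rw [← Polynomial.coeff_taylor_of_degree_le (hdeg j hj) ((j : ℝ) + N - i)]
  refine le_of_tendsto_of_tendsto'
    ((Polynomial.tendsto_eval_div_pow_coeff (hdeg i hi)).comp hx)
    ((Polynomial.tendsto_eval_div_pow_coeff
      (by rw [Polynomial.degree_taylor]; exact hdeg j hj)).comp hx) fun k => ?_
  have hle : f (i + N * k) ≤ f (j + N * (k + 1)) :=
    monotone_nat_of_le_succ hmono (by nlinarith)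
  rw [hrep, hrep, Nat.add_mul_mod_self_left, Nat.add_mul_mod_self_left,
    Nat.mod_eq_of_lt hi, Nat.mod_eq_of_lt hj] at hle
  have hshift : ((j + N * (k + 1) : ℕ) : ℝ) = ((i + N * k : ℕ) : ℝ) + ((j : ℝ) + N - i) := by
    push_cast
    ring
  rw [hshift, ← Polynomial.taylor_eval] at hle
  exact div_le_div_of_nonneg_right hle (by positivity)
end

section
/- Let p ≥ 3 be an integer and let i ∈ {1,…,p−1} be coprime to p. For n ∈ ℕ let N(p, i+np) be the number of numerical semigroups containing both p and i+np, and let Medim(p, i+np) be the number of numerical semigroups of maximal embedding dimension p containing i+np. Then the functions n ↦ N(p, i+np) and n ↦ Medim(p, i+np) are quasi-polynomials of degree p−1, each has constant leading coefficient (the coefficient of T^{p−1} is the same in all constituent polynomials), and their leading coefficients are equal. -/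
/-- The embedding dimension: cardinality of the minimal generating set
`(H∖{0}) ∖ ((H∖{0}) + (H∖{0}))`. -/
noncomputable def edim (H : Set ℕ) : ℕ :=
  ((H \ {0}) \ {n | ∃ a ∈ H \ {0}, ∃ b ∈ H \ {0}, n = a + b}).ncard

/-- The multiplicity: smallest positive element. -/
noncomputable def mult (H : Set ℕ) : ℕ := sInf {n | n ∈ H ∧ 0 < n}

/-- `N p q`: the number of numerical semigroups containing both `p` and `q`. -/
noncomputable def countNS (p q : ℕ) : ℕ :=
  {H : Set ℕ | IsNumericalSemigroup H ∧ p ∈ H ∧ q ∈ H}.ncard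

/-- `Medim p q`: the number of numerical semigroups of maximal embedding
dimension `p` (i.e. `m(H) = edim(H) = p`) containing `q`. -/
noncomputable def countMaxEdim (p q : ℕ) : ℕ :=
  {H : Set ℕ | IsNumericalSemigroup H ∧ mult H = p ∧ edim H = p ∧ q ∈ H}.ncard

open Classical in
/-- The real-valued indicator of a proposition. -/
noncomputable def ind (P : Prop) : ℝ := if P then 1 else 0

lemma ind_pos {P : Prop} (h : P) : ind P = 1 := if_pos h

lemma ind_neg {P : Prop} (h : ¬ P) : ind P = 0 := if_neg h

open Polynomial in
/-- Real-valued functions on `ℤ` given by a real polynomial on each residue class of some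
modulus. -/
def quasiPoly : Subalgebra ℝ (ℤ → ℝ) where
  carrier := {g | ∃ (N : ℕ) (c : ℤ → ℝ[X]), 0 < N ∧ ∀ x, g x = (c (x % N)).eval (x : ℝ)}
  mul_mem' := by
    rintro f g ⟨N, c, hN, hf⟩ ⟨M, d, hM, hg⟩
    refine ⟨N * M, fun k => c (k % N) * d (k % M), Nat.mul_pos hN hM, fun x => ?_⟩
    have h1 : x % ((N * M : ℕ) : ℤ) % N = x % N :=
      Int.emod_emod_of_dvd _ (by push_cast; exact dvd_mul_right _ _)
    have h2 : x % ((N * M : ℕ) : ℤ) % M = x % M :=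
      Int.emod_emod_of_dvd _ (by push_cast; exact dvd_mul_left _ _)
    simp only [Pi.mul_apply, hf, hg, h1, h2, eval_mul]
  add_mem' := by
    rintro f g ⟨N, c, hN, hf⟩ ⟨M, d, hM, hg⟩
    refine ⟨N * M, fun k => c (k % N) + d (k % M), Nat.mul_pos hN hM, fun x => ?_⟩
    have h1 : x % ((N * M : ℕ) : ℤ) % N = x % N :=
      Int.emod_emod_of_dvd _ (by push_cast; exact dvd_mul_right _ _)
    have h2 : x % ((N * M : ℕ) : ℤ) % M = x % M :=
      Int.emod_emod_of_dvd _ (by push_cast; exact dvd_mul_left _ _)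
    simp only [Pi.add_apply, hf, hg, h1, h2, eval_add]
  algebraMap_mem' r := ⟨1, fun _ => C r, one_pos, fun x => by simp⟩

lemma mul_intCast_mem_quasiPoly (a : ℤ) : (fun x : ℤ => ((a * x : ℤ) : ℝ)) ∈ quasiPoly :=
  ⟨1, fun _ => Polynomial.C (a : ℝ) * Polynomial.X, one_pos, fun x => by simp⟩

lemma dvd_mem_quasiPoly {N : ℕ} (hN : 0 < N) (a r : ℤ) :
    (fun x : ℤ => ind ((N : ℤ) ∣ a * x - r)) ∈ quasiPoly := by
  refine ⟨N, fun k => Polynomial.C (ind ((N : ℤ) ∣ a * k - r)), hN, fun x => ?_⟩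
  have : (N : ℤ) ∣ a * x - r ↔ (N : ℤ) ∣ a * (x % N) - r := by
    have h : a * x - r = (a * (x % N) - r) + N * (a * (x / N)) := by
      have := Int.emod_add_mul_ediv x N
      linear_combination (-a) * this
    rw [h, dvd_add_left (dvd_mul_right _ _)]
  simp only [this, Polynomial.eval_C]

/-- Generators of the algebra of piecewise quasi-polynomials on `V`: linear forms, indicators of
central half-spaces, and indicators of congruence classes. -/
def piecewiseGen (V : Type*) [AddCommGroup V] : Set (V → ℝ) :=
  {f | ∃ L : V →+ ℤ, f = fun v => (L v : ℝ)} ∪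
  {f | ∃ L : V →+ ℤ, f = fun v => ind (0 ≤ L v)} ∪
  {f | ∃ (L : V →+ ℤ) (N : ℕ) (r : ℤ), 0 < N ∧ f = fun v => ind ((N : ℤ) ∣ L v - r)}

/-- Functions that are piecewise quasi-polynomial with respect to a central hyperplane
arrangement. -/
noncomputable def piecewiseQP (V : Type*) [AddCommGroup V] : Subalgebra ℝ (V → ℝ) :=
  Algebra.adjoin ℝ (piecewiseGen V)

section PiecewiseQP

variable {V W : Type*} [AddCommGroup V] [AddCommGroup W]

lemma linear_mem (L : V →+ ℤ) : (fun v => (L v : ℝ)) ∈ piecewiseQP V :=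
  Algebra.subset_adjoin (Or.inl (Or.inl ⟨L, rfl⟩))

lemma nonneg_mem (L : V →+ ℤ) : (fun v => ind (0 ≤ L v)) ∈ piecewiseQP V :=
  Algebra.subset_adjoin (Or.inl (Or.inr ⟨L, rfl⟩))

lemma dvd_mem {N : ℕ} (hN : 0 < N) (L : V →+ ℤ) (r : ℤ) :
    (fun v => ind ((N : ℤ) ∣ L v - r)) ∈ piecewiseQP V :=
  Algebra.subset_adjoin (Or.inr ⟨L, N, r, hN, rfl⟩)

lemma const_mem (r : ℝ) : (fun _ : V => r) ∈ piecewiseQP V :=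
  (piecewiseQP V).algebraMap_mem r

lemma ind_and_mem {P Q : V → Prop} (hP : (fun v => ind (P v)) ∈ piecewiseQP V)
    (hQ : (fun v => ind (Q v)) ∈ piecewiseQP V) :
    (fun v => ind (P v ∧ Q v)) ∈ piecewiseQP V := by
  convert (piecewiseQP V).mul_mem hP hQ using 1
  ext v
  by_cases h1 : P v <;> by_cases h2 : Q v <;> simp [ind, h1, h2]

lemma ind_not_mem {P : V → Prop} (hP : (fun v => ind (P v)) ∈ piecewiseQP V) :
    (fun v => ind (¬ P v)) ∈ piecewiseQP V := by
  convert (piecewiseQP V).sub_mem (piecewiseQP V).one_mem hP using 1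
  ext v
  by_cases h1 : P v <;> simp [ind, h1]

lemma ind_forall_mem {ι : Type*} [Fintype ι] {P : ι → V → Prop}
    (hP : ∀ j, (fun v => ind (P j v)) ∈ piecewiseQP V) :
    (fun v => ind (∀ j, P j v)) ∈ piecewiseQP V := by
  convert (piecewiseQP V).prod_mem (t := Finset.univ) (fun j _ => hP j) using 1
  ext v
  classical
  simp only [ind]
  rw [Finset.prod_apply, Finset.prod_boole]
  simp

lemma ind_le_mem (L M : V →+ ℤ) :
    (fun v => ind (L v ≤ M v)) ∈ piecewiseQP V := by
  convert nonneg_mem (M - L) using 3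
  simp

lemma ind_lt_mem (L M : V →+ ℤ) :
    (fun v => ind (L v < M v)) ∈ piecewiseQP V := by
  convert ind_not_mem (ind_le_mem M L) using 3
  simp

lemma comp_mem (φ : V →+ W) {F : W → ℝ} (hF : F ∈ piecewiseQP W) : F ∘ φ ∈ piecewiseQP V := by
  induction hF using Algebra.adjoin_induction with
  | mem f hf =>
    rcases hf with (⟨L, rfl⟩ | ⟨L, rfl⟩) | ⟨L, N, r, hN, rfl⟩
    · exact linear_mem (L.comp φ)
    · exact nonneg_mem (L.comp φ)
    · exact dvd_mem hN (L.comp φ) r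
  | algebraMap r => exact const_mem r
  | add f g _ _ hf hg => exact add_mem hf hg
  | mul f g _ _ hf hg => exact mul_mem hf hg

lemma floor_mem (L : V →+ ℤ) (s : ℤ) {b : ℕ} (hb : 0 < b) :
    (fun v => (((L v + s) / (b : ℤ) : ℤ) : ℝ)) ∈ piecewiseQP V := by
  have : (fun v => (((L v + s) / (b : ℤ) : ℤ) : ℝ)) =
      ∑ r ∈ Finset.range b, (fun v => ind ((b : ℤ) ∣ L v - (r - s))) *
        ((fun v => (L v : ℝ)) + fun _ => ((s : ℝ) - r)) * (fun _ => (b : ℝ)⁻¹) := by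
    ext v
    have hb' : (b : ℤ) ≠ 0 := by positivity
    rw [Finset.sum_apply, Finset.sum_eq_single ((L v + s) % b).toNat]
    · have h1 : (((L v + s) % b).toNat : ℤ) = (L v + s) % b :=
        Int.toNat_of_nonneg (Int.emod_nonneg _ hb')
      have h2 : (b : ℤ) ∣ L v - ((((L v + s) % b).toNat : ℤ) - s) := by
        rw [h1]
        have := Int.dvd_self_sub_emod (x := L v + s) (m := b)
        convert this using 1; ring
      have h3 := Int.emod_add_mul_ediv (L v + s) b
      have h4 : ((((L v + s) % b).toNat : ℕ) : ℝ) = (((L v + s) % b : ℤ) : ℝ) := by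
        exact_mod_cast congrArg (Int.cast (R := ℝ)) h1
      have h5 : (b : ℝ) ≠ 0 := by positivity
      simp only [Pi.mul_apply, Pi.add_apply, ind_pos h2, h4]
      field_simp
      have h6 := congrArg (Int.cast (R := ℝ)) h3
      push_cast at h6 ⊢
      linarith
    · intro r hr hne
      have hr' := Finset.mem_range.1 hr
      have : ¬ (b : ℤ) ∣ L v - (r - s) := by
        intro hd
        apply hne
        have : (L v + s) % b = (r : ℤ) % b := by
          rw [Int.emod_eq_emod_iff_emod_sub_eq_zero]
          apply Int.emod_eq_zero_of_dvd
          convert hd using 1; ring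
        rw [this, Int.emod_eq_of_lt (by positivity) (by exact_mod_cast hr')]
        simp
      simp [ind_neg this]
    · intro h
      exfalso; apply h
      rw [Finset.mem_range]
      have := Int.emod_lt_of_pos (L v + s) (b := b) (by positivity)
      have := Int.emod_nonneg (L v + s) hb'
      omega
  rw [this]
  exact sum_mem fun r _ => mul_mem (mul_mem (dvd_mem hb L _)
    (add_mem (linear_mem L) (const_mem _))) (const_mem _)

lemma eval_mem (P : Polynomial ℝ) {f : V → ℝ} (hf : f ∈ piecewiseQP V) :
    (fun v => P.eval (f v)) ∈ piecewiseQP V := by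
  have : (fun v => P.eval (f v)) = Polynomial.aeval f P := by
    ext v
    rw [Polynomial.aeval_def, Polynomial.eval₂_eq_sum_range, Polynomial.eval_eq_sum_range,
      Finset.sum_apply]
    simp
  rw [this]
  exact Algebra.adjoin_le (Set.singleton_subset_iff.2 hf)
    (Polynomial.aeval_mem_adjoin_singleton ℝ f)

lemma exists_polynomial_backward_difference (P : Polynomial ℝ) :
    ∃ H : Polynomial ℝ, ∀ x : ℝ, H.eval x - H.eval (x - 1) = P.eval x := by
  induction P using Polynomial.induction_on' with
  | add P Q hP hQ =>
    obtain ⟨H, hH⟩ := hP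
    obtain ⟨K, hK⟩ := hQ
    refine ⟨H + K, fun x => ?_⟩
    simp only [Polynomial.eval_add, ← hH, ← hK]; ring
  | monomial n a =>
    refine ⟨Polynomial.C (a / (n + 1)) * ((Polynomial.bernoulli (n + 1)).map
      (algebraMap ℚ ℝ)).comp (1 + Polynomial.X), fun x => ?_⟩
    have h' := congrArg (fun Q : Polynomial ℚ => (Q.map (algebraMap ℚ ℝ)).eval x)
      (Polynomial.bernoulli_comp_one_add_X (n + 1))
    have hn : (n : ℝ) + 1 ≠ 0 := by positivity
    simp [Polynomial.map_comp] at h' ⊢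
    rw [h']
    field_simp
    ring

end PiecewiseQP

section Sums

variable {V W : Type*} [AddCommGroup V] [AddCommGroup W]

lemma exists_antiderivative {g : ℤ → ℝ} (hg : g ∈ quasiPoly) :
    ∃ G : ℤ → ℝ, (∀ x, G x - G (x - 1) = g x) ∧
      ∀ (L : V →+ ℤ) (s : ℤ) (b : ℕ), 0 < b →
        (fun v => G ((L v + s) / (b : ℤ))) ∈ piecewiseQP V := by
  obtain ⟨N, c, hN, hg⟩ := hg
  choose H hH using fun r : ℕ => exists_polynomial_backward_difference
    ((c r).comp (Polynomial.C (r : ℝ) + Polynomial.C (N : ℝ) * Polynomial.X))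
  have hN' : (N : ℤ) ≠ 0 := by positivity
  refine ⟨fun x => ∑ r ∈ Finset.range N, (H r).eval (((x - r) / (N : ℤ) : ℤ) : ℝ), ?_, ?_⟩
  · intro x
    have h0 : 0 ≤ x % N := Int.emod_nonneg _ hN'
    have h1 : x % N < N := Int.emod_lt_of_pos _ (by positivity)
    have h2 := Int.emod_add_mul_ediv x N
    rw [← Finset.sum_sub_distrib, Finset.sum_eq_single (x % N).toNat]
    · have h3 : (((x % N).toNat : ℕ) : ℤ) = x % N := Int.toNat_of_nonneg h0
      have h4 : (((x % N).toNat : ℕ) : ℝ) = ((x % N : ℤ) : ℝ) := by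
        exact_mod_cast congrArg (Int.cast (R := ℝ)) h3
      have e1 : (x - x % N) / N = x / N := by
        rw [show x - x % N = N * (x / N) by linarith, Int.mul_ediv_cancel_left _ hN']
      have e2 : (x - 1 - x % N) / N = x / N - 1 := by
        rw [show x - 1 - x % N = -1 + N * (x / N) by linarith,
          Int.add_mul_ediv_left _ _ hN', Int.neg_one_ediv, Int.sign_eq_one_of_pos (by positivity)]
        ring
      have h6 := congrArg (Int.cast (R := ℝ)) h2
      push_cast at h6
      rw [h3, e1, e2, hg]
      have := hH (x % N).toNat ((x / N : ℤ) : ℝ)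
      rw [Int.cast_sub, Int.cast_one, this, h3, h4]
      simp only [Polynomial.eval_comp, Polynomial.eval_add, Polynomial.eval_mul,
        Polynomial.eval_C, Polynomial.eval_X, h6]
    · intro r hr hne
      have hr' := Finset.mem_range.1 hr
      have : (x - r) / (N : ℤ) = (x - 1 - r) / (N : ℤ) := by
        rcases lt_trichotomy (x % N) r with h | h | h
        · rw [show x - r = (x % N - r + N) + N * (x / N - 1) by linarith,
            show x - 1 - r = (x % N - 1 - r + N) + N * (x / N - 1) by linarith,
            Int.add_mul_ediv_left _ _ hN', Int.add_mul_ediv_left _ _ hN',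
            Int.ediv_eq_zero_of_lt (a := x % N - r + N) (by omega) (by omega),
            Int.ediv_eq_zero_of_lt (a := x % N - 1 - r + N) (by omega) (by omega)]
        · omega
        · rw [show x - r = (x % N - r) + N * (x / N) by linarith,
            show x - 1 - r = (x % N - 1 - r) + N * (x / N) by linarith,
            Int.add_mul_ediv_left _ _ hN', Int.add_mul_ediv_left _ _ hN',
            Int.ediv_eq_zero_of_lt (a := x % N - r) (by omega) (by omega),
            Int.ediv_eq_zero_of_lt (a := x % N - 1 - r) (by omega) (by omega)]
      rw [this, sub_self]
    · intro h
      rw [Finset.mem_range] at h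
      omega
  · intro L s b hb
    have : (fun v => ∑ r ∈ Finset.range N,
        (H r).eval ((((L v + s) / (b : ℤ) - r) / (N : ℤ) : ℤ) : ℝ)) =
        ∑ r ∈ Finset.range N, fun v =>
          (H r).eval (((L v + (s - b * r)) / ((b * N : ℕ) : ℤ) : ℤ) : ℝ) := by
      ext v
      rw [Finset.sum_apply]
      refine Finset.sum_congr rfl fun r _ => ?_
      rw [Nat.cast_mul, ← Int.ediv_ediv_of_nonneg (by positivity),
        show L v + (s - b * r) = L v + s + b * (-r) by ring,
        Int.add_mul_ediv_left _ _ (by positivity)]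
      rfl
    rw [this]
    exact sum_mem fun r _ => eval_mem _ (floor_mem L _ (Nat.mul_pos hb hN))

lemma sum_Ioc_telescope {g G : ℤ → ℝ} (h : ∀ x, G x - G (x - 1) = g x) {a b : ℤ} (hab : a ≤ b) :
    ∑ x ∈ Finset.Ioc a b, g x = G b - G a := by
  induction b, hab using Int.leInduction with
  | base => simp
  | succ n hn ih =>
    have : Finset.Ioc a (n + 1) = insert (n + 1) (Finset.Ioc a n) := by
      ext x; simp only [Finset.mem_Ioc, Finset.mem_insert]; omega
    rw [this, Finset.sum_insert (by simp), ih, ← h (n + 1)]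
    simp

/-- Products of a coefficient in `V`, a quasi-polynomial in the last coordinate, and one lower
bound for the last coordinate. -/
def lowerBoundGen (V : Type*) [AddCommGroup V] : Set (V × ℤ → ℝ) :=
  {f | ∃ (a : V → ℝ) (g : ℤ → ℝ) (L : V →+ ℤ) (ε : ℤ) (b : ℕ), a ∈ piecewiseQP V ∧ g ∈ quasiPoly ∧
    (ε = 0 ∨ ε = 1) ∧ 0 < b ∧ f = fun y => a y.1 * g y.2 * ind (L y.1 + ε ≤ b * y.2)}

lemma lowerBoundGen_mul_mem {f f' : V × ℤ → ℝ} (hf : f ∈ lowerBoundGen V)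
    (hf' : f' ∈ lowerBoundGen V) : f * f' ∈ Submodule.span ℝ (lowerBoundGen V) := by
  obtain ⟨a, g, L, ε, b, ha, hg, hε, hb, rfl⟩ := hf
  obtain ⟨a', g', L', ε', b', ha', hg', hε', hb', rfl⟩ := hf'
  obtain ⟨A, hA, h1, h2⟩ : ∃ A : V → Prop, (fun v => ind (A v)) ∈ piecewiseQP V ∧
      (∀ v x, A v → L v + ε ≤ b * x → L' v + ε' ≤ b' * x) ∧
      (∀ v x, ¬ A v → L' v + ε' ≤ b' * x → L v + ε ≤ b * x) := by
    have hbz : (0 : ℤ) < b := by positivity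
    have hbz' : (0 : ℤ) < b' := by positivity
    by_cases h : ε = 0 ∧ ε' = 1
    · obtain ⟨rfl, rfl⟩ := h
      refine ⟨fun v => ((b : ℤ) • L') v < ((b' : ℤ) • L) v, ind_lt_mem _ _, ?_, ?_⟩
      · intro v x hA hx
        simp only [AddMonoidHom.smul_apply, smul_eq_mul] at hA
        have : (b : ℤ) * L' v < b * (b' * x) := by nlinarith
        have := lt_of_mul_lt_mul_left this hbz.le
        omega
      · intro v x hA hx
        simp only [AddMonoidHom.smul_apply, smul_eq_mul, not_lt] at hA
        have : (b' : ℤ) * L v ≤ b' * (b * x) := by nlinarith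
        have := le_of_mul_le_mul_left this hbz'
        omega
    · refine ⟨fun v => ((b : ℤ) • L') v ≤ ((b' : ℤ) • L) v, ind_le_mem _ _, ?_, ?_⟩
      · intro v x hA hx
        simp only [AddMonoidHom.smul_apply, smul_eq_mul] at hA
        have : (b : ℤ) * (L' v + ε' - 1) < b * (b' * x) := by
          rcases hε with rfl | rfl <;> rcases hε' with rfl | rfl <;> first | nlinarith | simp at h
        have := lt_of_mul_lt_mul_left this hbz.le
        omega
      · intro v x hA hx
        simp only [AddMonoidHom.smul_apply, smul_eq_mul, not_le] at hA
        have : (b' : ℤ) * (L v + ε - 1) < b' * (b * x) := by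
          rcases hε with rfl | rfl <;> rcases hε' with rfl | rfl <;> nlinarith
        have := lt_of_mul_lt_mul_left this hbz'.le
        omega
  have : (fun y : V × ℤ => a y.1 * g y.2 * ind (L y.1 + ε ≤ b * y.2)) *
      (fun y : V × ℤ => a' y.1 * g' y.2 * ind (L' y.1 + ε' ≤ b' * y.2)) =
      (fun y => (a * a' * fun v => ind (A v)) y.1 * (g * g') y.2 * ind (L y.1 + ε ≤ b * y.2)) +
      (fun y => (a * a' * fun v => ind (¬ A v)) y.1 * (g * g') y.2 *
        ind (L' y.1 + ε' ≤ b' * y.2)) := by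
    ext ⟨v, x⟩
    have h1 := h1 v x
    have h2 := h2 v x
    simp only [Pi.mul_apply, Pi.add_apply]
    by_cases hA : A v <;> by_cases hx : L v + ε ≤ b * x <;> by_cases hx' : L' v + ε' ≤ b' * x <;>
      first
      | exact absurd (h1 hA hx) hx'
      | exact absurd (h2 hA hx') hx
      | (simp only [ind, hA, hx, hx', if_true, if_false, not_true, not_false_eq_true]; ring)
  rw [this]
  exact add_mem
    (Submodule.subset_span
      ⟨_, _, L, ε, b, mul_mem (mul_mem ha ha') hA, mul_mem hg hg', hε, hb, rfl⟩)
    (Submodule.subset_span ⟨_, _, L', ε', b', mul_mem (mul_mem ha ha') (ind_not_mem hA),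
      mul_mem hg hg', hε', hb', rfl⟩)

lemma span_lowerBoundGen_mul_mem {f f' : V × ℤ → ℝ} (hf : f ∈ Submodule.span ℝ (lowerBoundGen V))
    (hf' : f' ∈ Submodule.span ℝ (lowerBoundGen V)) :
    f * f' ∈ Submodule.span ℝ (lowerBoundGen V) := by
  have h := Submodule.mul_mem_mul hf hf'
  rw [Submodule.span_mul_span] at h
  refine Submodule.span_le.2 ?_ h
  rintro _ ⟨x, hx, y, hy, rfl⟩
  exact lowerBoundGen_mul_mem hx hy

lemma separable_mem {a : V → ℝ} {g : ℤ → ℝ} (ha : a ∈ piecewiseQP V) (hg : g ∈ quasiPoly) :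
    (fun y : V × ℤ => a y.1 * g y.2 * ind (0 ≤ y.2)) ∈ Submodule.span ℝ (lowerBoundGen V) :=
  Submodule.subset_span ⟨a, g, 0, 0, 1, ha, hg, Or.inl rfl, one_pos, by simp⟩

/-- On the half-space `0 ≤ y.2`, every piecewise quasi-polynomial on `V × ℤ` is a combination of
functions with a single lower bound on the last coordinate. -/
lemma mul_ind_mem_span {F : V × ℤ → ℝ} (hF : F ∈ piecewiseQP (V × ℤ)) :
    (fun y => F y * ind (0 ≤ y.2)) ∈ Submodule.span ℝ (lowerBoundGen V) := by
  have hsplit (L : V × ℤ →+ ℤ) (v : V) (x : ℤ) :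
      L (v, x) = (L.comp (AddMonoidHom.inl V ℤ)) v + L (0, 1) * x := by
    have h : ((v, x) : V × ℤ) = (v, 0) + x • ((0, 1) : V × ℤ) := by simp
    rw [h, map_add, map_zsmul, smul_eq_mul, mul_comm]
    rfl
  induction hF using Algebra.adjoin_induction with
  | mem f hf =>
    rcases hf with (⟨L, rfl⟩ | ⟨L, rfl⟩) | ⟨L, N, r, hN, rfl⟩
    · convert add_mem (separable_mem (linear_mem (L.comp (AddMonoidHom.inl V ℤ)))
        (one_mem quasiPoly)) (separable_mem (one_mem (piecewiseQP V))
        (mul_intCast_mem_quasiPoly (L (0, 1)))) using 1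
      ext ⟨v, x⟩
      simp only [hsplit L v x, Pi.add_apply, Pi.one_apply, Int.cast_add]
      ring
    · rcases lt_trichotomy (L (0, 1)) 0 with h | h | h
      · have h1 : (fun y : V × ℤ => (1 : V → ℝ) y.1 * (1 : ℤ → ℝ) y.2 *
            ind ((L.comp (AddMonoidHom.inl V ℤ)) y.1 + 1 ≤ ((- L (0, 1)).toNat : ℕ) * y.2)) ∈
            Submodule.span ℝ (lowerBoundGen V) :=
          Submodule.subset_span ⟨1, 1, _, 1, _, one_mem _, one_mem _, Or.inr rfl, by omega, rfl⟩
        have h2 := separable_mem (one_mem (piecewiseQP V)) (one_mem quasiPoly)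
        convert sub_mem h2 (span_lowerBoundGen_mul_mem h1 h2) using 1
        ext ⟨v, x⟩
        simp only [hsplit L v x, Pi.sub_apply, Pi.mul_apply, Pi.one_apply, one_mul,
          Int.toNat_of_nonneg (show 0 ≤ - L (0, 1) by omega)]
        by_cases hx : 0 ≤ (L.comp (AddMonoidHom.inl V ℤ)) v + L (0, 1) * x
        · rw [ind_pos hx, ind_neg (P := _ + 1 ≤ _) (by rw [neg_mul]; omega)]; ring
        · rw [ind_neg hx, ind_pos (P := _ + 1 ≤ _) (by rw [neg_mul]; omega)]; ring
      · convert separable_mem (nonneg_mem (L.comp (AddMonoidHom.inl V ℤ))) (one_mem quasiPoly)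
          using 1
        ext ⟨v, x⟩
        simp only [hsplit L v x, h, zero_mul, add_zero, Pi.one_apply, mul_one]
      · have h1 : (fun y : V × ℤ => (1 : V → ℝ) y.1 * (1 : ℤ → ℝ) y.2 *
            ind ((-(L.comp (AddMonoidHom.inl V ℤ))) y.1 + 0 ≤ ((L (0, 1)).toNat : ℕ) * y.2)) ∈
            Submodule.span ℝ (lowerBoundGen V) :=
          Submodule.subset_span ⟨1, 1, _, 0, _, one_mem _, one_mem _, Or.inl rfl, by omega, rfl⟩
        have h2 := separable_mem (one_mem (piecewiseQP V)) (one_mem quasiPoly)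
        convert span_lowerBoundGen_mul_mem h1 h2 using 1
        ext ⟨v, x⟩
        simp only [hsplit L v x, Pi.mul_apply, Pi.one_apply, one_mul,
          Int.toNat_of_nonneg h.le]
        congr 2
        simp only [AddMonoidHom.neg_apply, eq_iff_iff]
        constructor <;> intro <;> linarith
    · have : (fun y => ind ((N : ℤ) ∣ L y - r) * ind (0 ≤ y.2)) = ∑ s ∈ Finset.range N,
          fun y : V × ℤ => (fun v => ind ((N : ℤ) ∣ (L.comp (AddMonoidHom.inl V ℤ)) v -
            (r - L (0, 1) * s))) y.1 * (fun x : ℤ => ind ((N : ℤ) ∣ 1 * x - s)) y.2 *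
            ind (0 ≤ y.2) := by
        ext ⟨v, x⟩
        have hN' : (N : ℤ) ≠ 0 := by positivity
        have h0 : 0 ≤ x % N := Int.emod_nonneg _ hN'
        have h1 : x % N < N := Int.emod_lt_of_pos _ (by positivity)
        have h2 := Int.emod_add_mul_ediv x N
        rw [Finset.sum_apply, Finset.sum_eq_single (x % N).toNat]
        · dsimp only
          rw [Int.toNat_of_nonneg h0, ind_pos (P := _ ∣ 1 * x - _)
            (by rw [one_mul]; exact Int.dvd_self_sub_emod), mul_one, hsplit]
          congr 2
          rw [eq_iff_iff, ← dvd_add_left (dvd_mul_right (N : ℤ) (L (0, 1) * (x / N)))]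
          have : (L.comp (AddMonoidHom.inl V ℤ)) v + L (0, 1) * x - r =
            (L.comp (AddMonoidHom.inl V ℤ)) v - (r - L (0, 1) * (x % N)) +
              N * (L (0, 1) * (x / N)) := by linear_combination (- L (0, 1)) * h2
          rw [this]
          simp
        · intro s hs hne
          have hs' := Finset.mem_range.1 hs
          dsimp only
          rw [ind_neg (P := _ ∣ 1 * x - _), mul_zero, zero_mul]
          intro hd
          apply hne
          rw [one_mul] at hd
          have := Int.emod_eq_emod_iff_emod_sub_eq_zero.2 (Int.emod_eq_zero_of_dvd hd)
          rw [Int.emod_eq_of_lt (a := (s : ℤ)) (by positivity) (by exact_mod_cast hs')] at this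
          omega
        · intro h
          rw [Finset.mem_range] at h
          omega
      rw [this]
      exact sum_mem fun s _ => separable_mem (dvd_mem hN _ _) (dvd_mem_quasiPoly hN 1 s)
  | algebraMap r =>
    convert separable_mem (const_mem (V := V) r) (one_mem quasiPoly) using 1
    ext y
    simp
  | add f g _ _ hf hg =>
    convert add_mem hf hg using 1
    ext y
    simp only [Pi.add_apply]; ring
  | mul f g _ _ hf hg =>
    convert span_lowerBoundGen_mul_mem hf hg using 1
    ext y
    simp only [Pi.mul_apply]
    by_cases h : 0 ≤ y.2 <;> simp [ind, h]

/-- Summing out one coordinate preserves piecewise quasi-polynomials. -/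
lemma sum_Icc_mem {F : V × ℤ → ℝ} (hF : F ∈ piecewiseQP (V × ℤ)) (B : V →+ ℤ) :
    (fun v => ∑ x ∈ Finset.Icc 0 (B v), F (v, x)) ∈ piecewiseQP V := by
  suffices h : ∀ f ∈ Submodule.span ℝ (lowerBoundGen V),
      (fun v => ∑ x ∈ Finset.Icc 0 (B v), f (v, x)) ∈ piecewiseQP V by
    convert h _ (mul_ind_mem_span hF) using 1
    ext v
    refine Finset.sum_congr rfl fun x hx => ?_
    rw [ind_pos (Finset.mem_Icc.1 hx).1, mul_one]
  intro f hf
  induction hf using Submodule.span_induction with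
  | zero => simpa using const_mem (V := V) 0
  | add f g _ _ hf hg =>
    convert add_mem hf hg using 1
    ext v
    simp [Finset.sum_add_distrib]
  | smul r f _ hf =>
    convert Subalgebra.smul_mem _ hf r using 1
    ext v
    simp [Finset.mul_sum]
  | mem f hf =>
    obtain ⟨a, g, L, ε, b, ha, hg, hε, hb, rfl⟩ := hf
    obtain ⟨G, hG, hGm⟩ := exists_antiderivative (V := V) hg
    have hbz : (0 : ℤ) < b := by positivity
    have hB : (fun v => G (B v)) ∈ piecewiseQP V := by simpa using hGm B 0 1 one_pos
    have hlow : (fun v => ind (L v + ε ≤ 0)) ∈ piecewiseQP V := by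
      rcases hε with rfl | rfl
      · simpa using ind_le_mem L 0
      · simpa [Int.add_one_le_iff] using ind_lt_mem L 0
    have key : (fun v => ∑ x ∈ Finset.Icc 0 (B v), a v * g x * ind (L v + ε ≤ b * x)) =
        a * (fun v => ind (0 ≤ B v)) *
        ((fun v => ind (L v + ε ≤ 0)) * ((fun v => G (B v)) - fun _ => G (-1)) +
          (fun v => ind (¬ L v + ε ≤ 0)) * (fun v => ind (L v ≤ ((b : ℤ) • B) v)) *
          ((fun v => G (B v)) - fun v => G ((L v + (ε - 1)) / (b : ℤ)))) := by
      ext v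
      simp only [Pi.mul_apply, Pi.add_apply, Pi.sub_apply, AddMonoidHom.smul_apply, smul_eq_mul]
      simp only [mul_assoc, ← Finset.mul_sum]
      congr 1
      by_cases h0 : 0 ≤ B v
      swap
      · rw [Finset.Icc_eq_empty h0, ind_neg h0]; simp
      rw [ind_pos h0, one_mul]
      have hlt (x : ℤ) : L v + ε ≤ b * x ↔ (L v + (ε - 1)) / (b : ℤ) < x := by
        rw [Int.ediv_lt_iff_lt_mul hbz, mul_comm x]
        omega
      by_cases h1 : L v + ε ≤ 0
      · rw [ind_pos h1, ind_neg (P := ¬ _) (not_not.2 h1), one_mul, zero_mul, add_zero,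
          ← sum_Ioc_telescope hG (by omega)]
        refine Finset.sum_congr (by ext; simp only [Finset.mem_Icc, Finset.mem_Ioc]; omega) ?_
        intro x hx
        rw [Finset.mem_Ioc] at hx
        rw [ind_pos, mul_one]
        have : 0 ≤ (b : ℤ) * x := mul_nonneg hbz.le (by omega)
        omega
      rw [ind_neg h1, ind_pos (P := ¬ _) h1, zero_mul, zero_add, one_mul]
      have hc : 0 ≤ (L v + (ε - 1)) / (b : ℤ) := Int.ediv_nonneg (by omega) hbz.le
      by_cases h2 : L v ≤ b * B v
      · have hcB : (L v + (ε - 1)) / (b : ℤ) ≤ B v := by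
          rw [Int.ediv_le_iff_le_mul hbz]
          nlinarith [hε.elim (fun h => h.le.trans zero_le_one) (fun h => h.le)]
        rw [ind_pos h2, one_mul, ← sum_Ioc_telescope hG hcB]
        symm
        refine (Finset.sum_congr rfl ?_).trans (Finset.sum_subset ?_ ?_)
        · intro x hx
          rw [ind_pos ((hlt x).2 (Finset.mem_Ioc.1 hx).1), mul_one]
        · intro x hx
          rw [Finset.mem_Ioc] at hx
          rw [Finset.mem_Icc]
          omega
        · intro x hx hx'
          rw [Finset.mem_Icc] at hx
          rw [Finset.mem_Ioc] at hx'
          rw [ind_neg, mul_zero]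
          rw [hlt]
          omega
      · rw [ind_neg h2, zero_mul]
        refine Finset.sum_eq_zero fun x hx => ?_
        rw [Finset.mem_Icc] at hx
        rw [ind_neg, mul_zero]
        have : (b : ℤ) * x ≤ b * B v := by nlinarith
        have : 0 ≤ ε := by omega
        omega
    dsimp only
    rw [key]
    refine mul_mem (mul_mem ha (nonneg_mem B)) (add_mem (mul_mem hlow (sub_mem hB (const_mem _)))
      (mul_mem (mul_mem (ind_not_mem hlow) (ind_le_mem _ _)) (sub_mem hB (hGm _ _ _ hb))))

open Classical in
/-- Summing over the lattice points of a dilated cube preserves piecewise quasi-polynomials. -/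
lemma sum_piFinset_Icc_mem (ι : Type*) [Fintype ι] : ∀ (V : Type _) [AddCommGroup V] (B : V →+ ℤ)
    (F : V × (ι → ℤ) → ℝ), F ∈ piecewiseQP (V × (ι → ℤ)) →
      (fun v => ∑ w ∈ Fintype.piFinset fun _ : ι => Finset.Icc 0 (B v), F (v, w)) ∈
        piecewiseQP V := by
  refine Fintype.induction_empty_option (P := fun ι _ => ∀ (V : Type _) [AddCommGroup V]
    (B : V →+ ℤ) (F : V × (ι → ℤ) → ℝ), F ∈ piecewiseQP (V × (ι → ℤ)) →
      (fun v => ∑ w ∈ Fintype.piFinset fun _ : ι => Finset.Icc 0 (B v), F (v, w)) ∈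
        piecewiseQP V) ?_ ?_ ?_ ι
  · intro α β _ e ih V _ B F hF
    let φ : V × (α → ℤ) →+ V × (β → ℤ) :=
      { toFun := fun y => (y.1, y.2 ∘ e.symm), map_zero' := rfl, map_add' := fun _ _ => rfl }
    convert ih V B (F ∘ φ) (comp_mem φ hF) using 1
    ext v
    refine (Finset.sum_nbij' (fun w => w ∘ e.symm) (fun w => w ∘ e) ?_ ?_ ?_ ?_ ?_).symm
    · intro w hw
      simp only [Fintype.mem_piFinset] at hw ⊢
      exact fun a => hw _
    · intro w hw
      simp only [Fintype.mem_piFinset] at hw ⊢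
      exact fun a => hw _
    · intro w _; ext; simp
    · intro w _; ext; simp
    · intro w _; rfl
  · intro V _ B F hF
    let φ : V →+ V × (PEmpty → ℤ) := AddMonoidHom.inl _ _
    convert comp_mem φ hF using 1
    ext v
    exact Finset.sum_eq_single_of_mem (φ v).2 
      ((@Fintype.mem_piFinset _ (fun _ _ => propDecidable _) _ _ _ _).2 fun a => a.elim)
      fun w _ hw => (hw (funext fun a => a.elim)).elim
  · intro α _ ih V _ B F hF
    let φ : (V × ℤ) × (α → ℤ) →+ V × (Option α → ℤ) :=
      { toFun := fun y => (y.1.1, fun o => o.elim y.1.2 y.2)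
        map_zero' := Prod.ext rfl (funext fun o => by cases o <;> rfl)
        map_add' := fun _ _ => Prod.ext rfl (funext fun o => by cases o <;> rfl) }
    convert sum_Icc_mem (ih (V × ℤ) (B.comp (AddMonoidHom.fst V ℤ)) (F ∘ φ) (comp_mem φ hF)) B
      using 1
    ext v
    refine Eq.trans ?_ (Finset.sum_product' (Finset.Icc 0 (B v))
      (Fintype.piFinset fun _ : α => Finset.Icc 0 (B v)) fun x w => (F ∘ φ) ((v, x), w))
    refine (Finset.sum_nbij' (fun y o => o.elim y.1 y.2) (fun w => (w none, fun a => w (some a)))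
      ?_ ?_ ?_ ?_ ?_).symm
    · rintro ⟨x, w⟩ hw
      simp only [Finset.mem_product, Fintype.mem_piFinset] at hw ⊢
      rintro (_ | a)
      · exact hw.1
      · exact hw.2 a
    · intro w hw
      simp only [Finset.mem_product, Fintype.mem_piFinset] at hw ⊢
      exact ⟨hw _, fun a => hw _⟩
    · rintro ⟨x, w⟩ _; rfl
    · intro w _; ext o; cases o <;> rfl
    · rintro ⟨x, w⟩ _; rfl

/-- On positive integers, a piecewise quasi-polynomial in one variable is a quasi-polynomial. -/
lemma exists_quasiPoly_eq_of_pos {F : ℤ → ℝ} (hF : F ∈ piecewiseQP ℤ) :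
    ∃ g ∈ quasiPoly, ∀ t, 0 < t → F t = g t := by
  have hL (L : ℤ →+ ℤ) (t : ℤ) : L t = L 1 * t := by
    conv_lhs => rw [show t = t • (1 : ℤ) by simp, map_zsmul, smul_eq_mul, mul_comm]
  induction hF using Algebra.adjoin_induction with
  | mem f hf =>
    rcases hf with (⟨L, rfl⟩ | ⟨L, rfl⟩) | ⟨L, N, r, hN, rfl⟩
    · exact ⟨_, mul_intCast_mem_quasiPoly (L 1), fun t _ => congrArg Int.cast (hL L t)⟩
    · refine ⟨_, quasiPoly.algebraMap_mem (ind (0 ≤ L 1)), fun t ht => ?_⟩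
      simp only [hL L t, mul_nonneg_iff_of_pos_right ht]
      rfl
    · exact ⟨_, dvd_mem_quasiPoly hN (L 1) r, fun t _ => by simp only [hL L t]⟩
  | algebraMap r => exact ⟨_, quasiPoly.algebraMap_mem r, fun _ _ => rfl⟩
  | add f g _ _ hf hg =>
    obtain ⟨f', hf', hf⟩ := hf
    obtain ⟨g', hg', hg⟩ := hg
    exact ⟨_, add_mem hf' hg', fun t ht => by simp [hf t ht, hg t ht]⟩
  | mul f g _ _ hf hg =>
    obtain ⟨f', hf', hf⟩ := hf
    obtain ⟨g', hg', hg⟩ := hg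
    exact ⟨_, mul_mem hf' hg', fun t ht => by simp [hf t ht, hg t ht]⟩

/-- Restricting a quasi-polynomial to an arithmetic progression. -/
lemma quasiPoly_progression {g : ℤ → ℝ} (hg : g ∈ quasiPoly) (i p : ℕ) :
    ∃ (N : ℕ) (c : ℕ → Polynomial ℝ), 0 < N ∧
      ∀ n : ℕ, g ((i + n * p : ℕ) : ℤ) = (c (n % N)).eval (n : ℝ) := by
  obtain ⟨N, c, hN, hg⟩ := hg
  refine ⟨N, fun k => (c (((i + k * p : ℕ) : ℤ) % N)).comp
    (Polynomial.C (i : ℝ) + Polynomial.X * Polynomial.C (p : ℝ)), hN, fun n => ?_⟩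
  have : ((i + n % N * p : ℕ) : ℤ) % N = ((i + n * p : ℕ) : ℤ) % N := by
    norm_cast
    exact Nat.ModEq.add_left _ ((Nat.mod_modEq n N).mul_right _)
  rw [hg]
  simp only [this]
  simp

end Sums

/-- Apéry functions, with respect to `p`, of the numerical semigroups containing `p` and `q`. -/
def aperySet (p q : ℕ) : Set (ZMod p → ℤ) :=
  {w | (∀ j, 0 ≤ w j) ∧ (∀ j, (w j : ZMod p) = j) ∧ w 0 ≤ 0 ∧ (∀ j l, w (j + l) ≤ w j + w l) ∧
    w q ≤ q}

/-- The strict inequalities characterizing maximal embedding dimension. -/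
def strictAperySet (p q : ℕ) : Set (ZMod p → ℤ) :=
  {w | w ∈ aperySet p q ∧ ∀ j l, j ≠ 0 → l ≠ 0 → j + l ≠ 0 → w (j + l) < w j + w l}

/-- The subset of `ℕ` determined by an Apéry function. -/
def aperySemigroup {p : ℕ} (w : ZMod p → ℤ) : Set ℕ := {x | w (x : ZMod p) ≤ x}

/-- The minimal generating set of `H`. -/
def minGens (H : Set ℕ) : Set ℕ :=
  (H \ {0}) \ {n | ∃ a ∈ H \ {0}, ∃ b ∈ H \ {0}, n = a + b}

section Apery

variable {p q : ℕ} {w : ZMod p → ℤ}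

lemma aperySet_zero (hw : w ∈ aperySet p q) : w 0 = 0 := le_antisymm hw.2.2.1 (hw.1 0)

lemma aperySet_pos (hw : w ∈ aperySet p q) {j : ZMod p} (hj : j ≠ 0) : 0 < w j := by
  refine lt_of_le_of_ne (hw.1 j) fun h => hj ?_
  rw [← hw.2.1 j, ← h, Int.cast_zero]

lemma exists_eq_add_mul (hw : w ∈ aperySet p q) {x : ℕ} (hx : x ∈ aperySemigroup w) (hp : 0 < p) :
    ∃ k : ℕ, (x : ℤ) = w x + k * p := by
  have h : (((x : ℤ) - w x : ℤ) : ZMod p) = 0 := by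
    push_cast
    rw [hw.2.1, sub_self]
  obtain ⟨k, hk⟩ := (ZMod.intCast_zmod_eq_zero_iff_dvd _ _).1 h
  have hx' : w x ≤ x := hx
  have : 0 ≤ k := by
    by_contra! hneg
    have : (p : ℤ) * k < 0 := mul_neg_of_pos_of_neg (by exact_mod_cast hp) hneg
    omega
  lift k to ℕ using this
  exact ⟨k, by linarith⟩

lemma apery_isNumericalSemigroup [NeZero p] (hw : w ∈ aperySet p q) :
    IsNumericalSemigroup (aperySemigroup w) ∧ p ∈ aperySemigroup w ∧ q ∈ aperySemigroup w := by
  have h0 := aperySet_zero hw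
  obtain ⟨hnn, -, -, hadd, hq⟩ := hw
  refine ⟨⟨by simp [aperySemigroup, h0], fun a ha b hb => ?_, ?_⟩, by simp [aperySemigroup, h0], hq⟩
  · simp only [aperySemigroup, Set.mem_ofPred_eq, Nat.cast_add] at *
    exact (hadd _ _).trans (add_le_add ha hb)
  · refine (Set.finite_Iio (∑ j, w j).toNat).subset fun x hx => ?_
    simp only [aperySemigroup, Set.mem_compl_iff, Set.mem_ofPred_eq, not_le, Set.mem_Iio] at *
    have := Finset.single_le_sum (fun j _ => hnn j) (Finset.mem_univ (x : ZMod p))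
    omega

lemma apery_injOn [NeZero p] : Set.InjOn (aperySemigroup (p := p)) (aperySet p q) := by
  have key : ∀ w ∈ aperySet p q, ∀ w' ∈ aperySet p q, aperySemigroup w = aperySemigroup w' →
      ∀ j, w' j ≤ w j := by
    intro w hw w' hw' h j
    obtain ⟨m, hm⟩ := Int.eq_ofNat_of_zero_le (hw.1 j)
    have hmj : (m : ZMod p) = j := by
      have := hw.2.1 j
      rwa [hm, Int.cast_natCast] at this
    have : m ∈ aperySemigroup w := by
      change w m ≤ m
      rw [hmj, hm]
    rw [h] at this
    change w' m ≤ m at this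
    rwa [hmj, ← hm] at this
  intro w hw w' hw' h
  ext j
  exact le_antisymm (key w' hw' w hw h.symm j) (key w hw w' hw' h j)

lemma exists_apery [NeZero p] {H : Set ℕ} (hH : IsNumericalSemigroup H) (hp : p ∈ H) (hq : q ∈ H) :
    ∃ w ∈ aperySet p q, aperySemigroup w = H := by
  obtain ⟨h0, hadd, hfin⟩ := hH
  have hne (j : ZMod p) : {x : ℕ | x ∈ H ∧ (x : ZMod p) = j}.Nonempty := by
    have hinf : (Set.range fun k : ℕ => j.val + k * p).Infinite :=
      Set.infinite_range_of_injective fun a b hab =>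
        Nat.eq_of_mul_eq_mul_right (NeZero.pos p) (Nat.add_left_cancel hab)
    obtain ⟨x, ⟨k, rfl⟩, hx⟩ := hinf.exists_notMem_finite hfin
    exact ⟨_, not_not.1 hx, by simp⟩
  let m : ZMod p → ℕ := fun j => sInf {x : ℕ | x ∈ H ∧ (x : ZMod p) = j}
  have hm (j : ZMod p) : m j ∈ H ∧ (m j : ZMod p) = j := Nat.sInf_mem (hne j)
  have hle {x : ℕ} (hx : x ∈ H) : m x ≤ x := Nat.sInf_le ⟨hx, rfl⟩
  refine ⟨fun j => m j,
    ⟨fun j => Nat.cast_nonneg _, fun j => by simpa using (hm j).2, ?_, ?_, ?_⟩, ?_⟩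
  · have := hle h0
    simpa using this
  · intro j l
    have := hle (hadd _ (hm j).1 _ (hm l).1)
    rw [Nat.cast_add, (hm j).2, (hm l).2] at this
    exact Nat.cast_add (R := ℤ) _ _ ▸ Nat.cast_le.2 this
  · exact Nat.cast_le.2 (hle hq)
  · ext x
    simp only [aperySemigroup, Set.mem_ofPred_eq, Nat.cast_le]
    refine ⟨fun hx => ?_, hle⟩
    have hd : (p : ℤ) ∣ (x : ℤ) - m x := by
      rw [← ZMod.intCast_zmod_eq_zero_iff_dvd]
      push_cast
      rw [(hm x).2, sub_self]
    have hd' : p ∣ x - m x := by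
      rw [← Int.natCast_dvd_natCast]
      rwa [Nat.cast_sub hx]
    obtain ⟨k, hk⟩ := hd'
    have hkp : ∀ k : ℕ, p * k ∈ H := fun k => by
      induction k with
      | zero => exact h0
      | succ k ih => exact hadd _ ih _ hp
    have := hadd _ (hm x).1 _ (hkp k)
    rwa [← hk, Nat.add_sub_cancel' hx] at this

lemma countNS_eq_ncard (p q : ℕ) [NeZero p] : countNS p q = (aperySet p q).ncard := by
  rw [countNS, ← apery_injOn.ncard_image]
  congr 1
  ext H
  constructor
  · rintro ⟨hH, hp, hq⟩
    exact exists_apery hH hp hq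
  · rintro ⟨w, hw, rfl⟩
    exact apery_isNumericalSemigroup hw

/-- The generators read off from an Apéry function. -/
def aperyGen (w : ZMod p → ℤ) (j : ZMod p) : ℕ := if j = 0 then p else (w j).toNat

lemma aperyGen_cast (hw : w ∈ aperySet p q) {j : ZMod p} (hj : j ≠ 0) :
    (aperyGen w j : ℤ) = w j := by
  rw [aperyGen, if_neg hj]
  exact Int.toNat_of_nonneg (hw.1 j)

lemma aperyGen_residue (hw : w ∈ aperySet p q) (j : ZMod p) : (aperyGen w j : ZMod p) = j := by
  by_cases hj : j = 0
  · simp [aperyGen, hj]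
  · rw [← Int.cast_natCast, aperyGen_cast hw hj, hw.2.1]

lemma aperyGen_mem [NeZero p] (hw : w ∈ aperySet p q) (j : ZMod p) :
    aperyGen w j ∈ aperySemigroup w \ {0} := by
  refine ⟨?_, ?_⟩
  · change w _ ≤ _
    rw [aperyGen_residue hw]
    by_cases hj : j = 0
    · rw [hj, aperySet_zero hw]
      positivity
    · exact (aperyGen_cast hw hj).ge
  · change aperyGen w j ≠ 0
    by_cases hj : j = 0
    · simp [aperyGen, hj, NeZero.ne]
    · have := aperyGen_cast hw hj
      have := aperySet_pos hw hj
      omega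

lemma minGens_subset [NeZero p] (hw : w ∈ aperySet p q) :
    minGens (aperySemigroup w) ⊆ Set.range (aperyGen w) := by
  rintro x ⟨⟨hx, hx0⟩, hsum⟩
  replace hx0 : x ≠ 0 := hx0
  refine ⟨x, ?_⟩
  obtain ⟨k, hk⟩ := exists_eq_add_mul hw hx (NeZero.pos p)
  have hmul (k : ℕ) (hk : k ≠ 0) : k * p ∈ aperySemigroup w \ {0} := by
    refine ⟨?_, mul_ne_zero hk (NeZero.ne p)⟩
    change w _ ≤ _
    rw [Nat.cast_mul, ZMod.natCast_self, mul_zero, aperySet_zero hw]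
    positivity
  by_cases hj : (x : ZMod p) = 0
  · rw [hj, aperySet_zero hw, zero_add] at hk
    rw [aperyGen, if_pos hj]
    have hk' : x = k * p := by exact_mod_cast hk
    rcases k with _ | _ | k
    · simp at hk'; omega
    · simpa using hk'.symm
    · exact absurd ⟨_, hmul (k + 1) k.succ_ne_zero, _, hmul 1 one_ne_zero, by rw [hk']; ring⟩ hsum
  · rw [← aperyGen_cast hw hj] at hk
    have hk' : x = aperyGen w x + k * p := by exact_mod_cast hk
    rcases k with _ | k
    · simpa using hk'.symm
    · exact absurd ⟨_, aperyGen_mem hw x, _, hmul (k + 1) k.succ_ne_zero, hk'⟩ hsum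

lemma ncard_range_aperyGen [NeZero p] (hw : w ∈ aperySet p q) :
    (Set.range (aperyGen w)).ncard = p := by
  rw [← Set.image_univ, Set.ncard_image_of_injective _
    (Function.LeftInverse.injective (aperyGen_residue hw)), Set.ncard_univ, Nat.card_zmod]

lemma strict_of_edim [NeZero p] (hw : w ∈ aperySet p q) (h : edim (aperySemigroup w) = p) :
    w ∈ strictAperySet p q := by
  have heq : minGens (aperySemigroup w) = Set.range (aperyGen w) :=
    Set.eq_of_subset_of_ncard_le (minGens_subset hw)
      ((ncard_range_aperyGen hw).trans h.symm).le (Set.finite_range _)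
  refine ⟨hw, fun j l hj hl hjl => lt_of_le_of_ne (hw.2.2.2.1 j l) fun hsum => ?_⟩
  have hmem : aperyGen w (j + l) ∈ minGens (aperySemigroup w) := heq ▸ Set.mem_range_self _
  refine hmem.2 ⟨_, aperyGen_mem hw j, _, aperyGen_mem hw l, ?_⟩
  rw [← aperyGen_cast hw hj, ← aperyGen_cast hw hl, ← aperyGen_cast hw hjl] at hsum
  exact_mod_cast hsum

lemma strict_add_le (hw : w ∈ strictAperySet p q) {j l : ZMod p} (hj : j ≠ 0)
    (hl : l ≠ 0) (hjl : j + l ≠ 0) : w (j + l) + p ≤ w j + w l := by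
  have hlt := hw.2 j l hj hl hjl
  have hd : (p : ℤ) ∣ w j + w l - w (j + l) := by
    rw [← ZMod.intCast_zmod_eq_zero_iff_dvd]
    push_cast
    rw [hw.1.2.1, hw.1.2.1, hw.1.2.1, sub_self]
  have := Int.le_of_dvd (by omega) hd
  omega

lemma le_of_strict [NeZero p] (hp : 3 ≤ p) (hw : w ∈ strictAperySet p q) {j : ZMod p}
    (hj : j ≠ 0) : (p : ℤ) ≤ w j := by
  obtain ⟨m, hm, hmin⟩ := Finset.exists_min_image (Finset.univ.filter fun j : ZMod p => j ≠ 0) w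
    ⟨j, by simpa using hj⟩
  simp only [Finset.mem_filter, Finset.mem_univ, true_and] at hm hmin
  refine le_trans ?_ (hmin j hj)
  by_contra! hlt
  by_cases h2 : m + m = 0
  · obtain ⟨l, hl⟩ : ∃ l : ZMod p, l ∉ ({0, m} : Finset (ZMod p)) := by
      by_contra! hall
      have h1 := Finset.card_le_card (fun x _ => hall x : Finset.univ ⊆ ({0, m} : Finset (ZMod p)))
      rw [Finset.card_univ, ZMod.card] at h1
      have := h1.trans Finset.card_le_two
      omega
    simp only [Finset.mem_insert, Finset.mem_singleton, not_or] at hl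
    have hml : m + l ≠ 0 := fun h => hl.2 (add_left_cancel (h.trans h2.symm))
    have hmml : m + (m + l) = l := by rw [← add_assoc, h2, zero_add]
    have h3 := strict_add_le hw hm hl.1 hml
    have h4 := strict_add_le hw hm hml (by rw [hmml]; exact hl.1)
    rw [hmml] at h4
    omega
  · have := strict_add_le hw hm hm h2
    have := hmin _ h2
    omega

lemma le_of_mem_apery [NeZero p] (hp : 3 ≤ p) (hw : w ∈ strictAperySet p q) {x : ℕ}
    (hx : x ∈ aperySemigroup w) (hx0 : x ≠ 0) : p ≤ x := by
  by_cases hj : (x : ZMod p) = 0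
  · exact Nat.le_of_dvd (Nat.pos_of_ne_zero hx0) ((ZMod.natCast_eq_zero_iff _ _).1 hj)
  · have := le_of_strict hp hw hj
    have hx' : w x ≤ x := hx
    omega

lemma mult_edim_of_strict [NeZero p] (hp : 3 ≤ p) (hw : w ∈ strictAperySet p q) :
    mult (aperySemigroup w) = p ∧ edim (aperySemigroup w) = p := by
  refine ⟨IsLeast.csInf_eq ⟨⟨(apery_isNumericalSemigroup hw.1).2.1, NeZero.pos p⟩,
    fun x hx => le_of_mem_apery hp hw hx.1 hx.2.ne'⟩, ?_⟩
  refine Eq.trans ?_ (ncard_range_aperyGen hw.1)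
  refine congrArg Set.ncard (Set.Subset.antisymm (minGens_subset hw.1) ?_)
  rintro _ ⟨j, rfl⟩
  refine ⟨aperyGen_mem hw.1 j, ?_⟩
  rintro ⟨a, ⟨ha, ha0⟩, b, ⟨hb, hb0⟩, hab⟩
  replace ha0 : a ≠ 0 := ha0
  replace hb0 : b ≠ 0 := hb0
  by_cases hj : j = 0
  · have := le_of_mem_apery hp hw ha ha0
    rw [aperyGen, if_pos hj] at hab
    omega
  · have hwj := aperyGen_cast hw.1 hj
    have hres : j = (a : ZMod p) + b := by
      rw [← aperyGen_residue hw.1 j, hab, Nat.cast_add]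
    replace ha : w a ≤ a := ha
    replace hb : w b ≤ b := hb
    by_cases ha' : (a : ZMod p) = 0
    · rw [ha', zero_add] at hres
      rw [← hres] at hb
      omega
    by_cases hb' : (b : ZMod p) = 0
    · rw [hb', add_zero] at hres
      rw [← hres] at ha
      omega
    have := hw.2 _ _ ha' hb' (hres ▸ hj)
    rw [← hres] at this
    omega

lemma countMaxEdim_eq_ncard (hp : 3 ≤ p) (q : ℕ) [NeZero p] :
    countMaxEdim p q = (strictAperySet p q).ncard := by
  rw [countMaxEdim, ← (apery_injOn.mono fun w (hw : w ∈ strictAperySet p q) => hw.1).ncard_image]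
  congr 1
  ext H
  constructor
  · rintro ⟨hH, hm, he, hq⟩
    have hpm : p ∈ H := by
      rw [mult] at hm
      have h := Nat.sInf_mem (Nat.nonempty_of_pos_sInf (hm ▸ NeZero.pos p))
      exact hm ▸ h.1
    obtain ⟨w, hw, rfl⟩ := exists_apery hH hpm hq
    exact ⟨w, strict_of_edim hw he, rfl⟩
  · rintro ⟨w, hw, rfl⟩
    obtain ⟨h1, h2⟩ := mult_edim_of_strict hp hw
    have h := apery_isNumericalSemigroup hw.1
    exact ⟨h.1, h1, h2, h.2.2⟩

end Apery

section Count

lemma ind_imp_mem {V : Type*} [AddCommGroup V] (Q : Prop) {P : V → Prop}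
    (hP : (fun v => ind (P v)) ∈ piecewiseQP V) : (fun v => ind (Q → P v)) ∈ piecewiseQP V := by
  by_cases hQ : Q
  · simpa only [hQ, true_imp_iff] using hP
  · simpa only [hQ, false_imp_iff] using const_mem (ind True)

lemma exists_quasiPolynomial_ncard {ι : Type} [Fintype ι] {S : ℤ × (ι → ℤ) → Prop}
    (hS : (fun v => ind (S v)) ∈ piecewiseQP (ℤ × (ι → ℤ))) {i : ℕ} (hi : 1 ≤ i) (p b : ℕ)
    (A : ℕ → Set (ι → ℤ)) (hA : ∀ n w, w ∈ A n ↔ S (((i + n * p : ℕ) : ℤ), w))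
    (hbox : ∀ n, ∀ w ∈ A n, ∀ j, 0 ≤ w j ∧ w j ≤ b * (i + n * p : ℕ)) :
    ∃ (N : ℕ) (c : ℕ → Polynomial ℝ), 0 < N ∧
      ∀ n : ℕ, ((A n).ncard : ℝ) = (c (n % N)).eval (n : ℝ) := by
  classical
  obtain ⟨g, hg, hFg⟩ := exists_quasiPoly_eq_of_pos
    (sum_piFinset_Icc_mem ι ℤ (AddMonoidHom.mulLeft (b : ℤ)) _ hS)
  obtain ⟨N, c, hN, hc⟩ := quasiPoly_progression hg i p
  refine ⟨N, c, hN, fun n => ?_⟩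
  rw [← hc n, ← hFg _ (by exact_mod_cast (show 0 < i + n * p by omega))]
  have hset : A n = ((Fintype.piFinset fun _ : ι =>
      Finset.Icc (0 : ℤ) (b * (i + n * p : ℕ))).filter fun w => w ∈ A n : Finset (ι → ℤ)) := by
    ext w
    simp only [Finset.coe_filter, Fintype.mem_piFinset, Finset.mem_Icc, Set.mem_ofPred_eq]
    exact ⟨fun h => ⟨hbox n w h, h⟩, fun h => h.2⟩
  rw [hset, Set.ncard_coe_finset, Finset.card_filter, Nat.cast_sum]
  refine Finset.sum_congr rfl fun w _ => ?_
  simp only [ind, ← hA n w, Nat.cast_ite, Nat.cast_one, Nat.cast_zero]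

variable {p q : ℕ} {w : ZMod p → ℤ}

lemma apery_mul_le (hw : w ∈ aperySet p q) (s : ℕ) : w (s * q) ≤ s * q := by
  obtain ⟨-, -, h0, hadd, hq⟩ := hw
  induction s with
  | zero => simpa using h0
  | succ s ih =>
    have := hadd (s * q) q
    push_cast
    rw [add_mul, add_mul, one_mul, one_mul]
    linarith

lemma apery_le [NeZero p] (hw : w ∈ aperySet p q) (hc : q.Coprime p) (j : ZMod p) :
    w j ≤ p * q := by
  have h := apery_mul_le hw (j * (q : ZMod p)⁻¹).val
  have hu : (q : ZMod p) * (q : ZMod p)⁻¹ = 1 := ZMod.coe_mul_inv_eq_one q hc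
  rw [ZMod.natCast_zmod_val, mul_assoc, mul_comm _ (q : ZMod p), hu, mul_one] at h
  refine h.trans ?_
  gcongr
  exact (ZMod.val_lt _).le

/-- Membership in `aperySet`, as a condition on the pair `(q, w)`. -/
def AperyCond (p : ℕ) (j₀ : ZMod p) (y : ℤ × (ZMod p → ℤ)) : Prop :=
  (∀ j, 0 ≤ y.2 j) ∧ (∀ j : ZMod p, (p : ℤ) ∣ y.2 j - j.val) ∧ y.2 0 ≤ 0 ∧
    (∀ j l, y.2 (j + l) ≤ y.2 j + y.2 l) ∧ y.2 j₀ ≤ y.1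

lemma mem_aperySet_iff [NeZero p] : w ∈ aperySet p q ↔ AperyCond p q (q, w) := by
  have (j : ZMod p) : (w j : ZMod p) = j ↔ (p : ℤ) ∣ w j - j.val := by
    rw [← ZMod.intCast_zmod_eq_zero_iff_dvd]
    push_cast
    rw [ZMod.natCast_zmod_val, sub_eq_zero]
  simp only [AperyCond, ← this]
  rfl

variable [NeZero p] (j₀ : ZMod p)

/-- The coordinate functions on `ℤ × (ZMod p → ℤ)`. -/
def coord (j : ZMod p) : ℤ × (ZMod p → ℤ) →+ ℤ :=
  (Pi.evalAddMonoidHom _ j).comp (AddMonoidHom.snd _ _)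

lemma ind_aperyCond_mem : (fun y => ind (AperyCond p j₀ y)) ∈ piecewiseQP _ :=
  ind_and_mem (ind_forall_mem fun j => nonneg_mem (coord j)) <|
    ind_and_mem (ind_forall_mem fun j => dvd_mem (NeZero.pos p) (coord j) _) <|
    ind_and_mem (ind_le_mem (coord 0) 0) <|
    ind_and_mem (ind_forall_mem fun j => ind_forall_mem fun l =>
      ind_le_mem (coord (j + l)) (coord j + coord l)) <|
    ind_le_mem (coord j₀) (AddMonoidHom.fst _ _)

lemma ind_strictAperyCond_mem : (fun y => ind (AperyCond p j₀ y ∧ ∀ j l : ZMod p, j ≠ 0 → l ≠ 0 →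
    j + l ≠ 0 → y.2 (j + l) < y.2 j + y.2 l)) ∈ piecewiseQP _ :=
  ind_and_mem (ind_aperyCond_mem j₀) <| ind_forall_mem fun j => ind_forall_mem fun l =>
    ind_imp_mem _ <| ind_imp_mem _ <| ind_imp_mem _ <|
      ind_lt_mem (coord (j + l)) (coord j + coord l)

variable {i : ℕ}

lemma exists_quasiPolynomial_aperySet (hi : 1 ≤ i) (hc : i.Coprime p) :
    ∃ (N : ℕ) (c : ℕ → Polynomial ℝ), 0 < N ∧
      ∀ n : ℕ, ((aperySet p (i + n * p)).ncard : ℝ) = (c (n % N)).eval (n : ℝ) := by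
  refine exists_quasiPolynomial_ncard (ind_aperyCond_mem (i : ZMod p)) hi p p
    (fun n => aperySet p (i + n * p)) (fun n w => ?_) fun n w hw j => ⟨hw.1 j, ?_⟩
  · rw [mem_aperySet_iff]
    simp
  · exact apery_le hw (by simpa using hc) j

lemma exists_quasiPolynomial_strictAperySet (hi : 1 ≤ i) (hc : i.Coprime p) :
    ∃ (N : ℕ) (c : ℕ → Polynomial ℝ), 0 < N ∧
      ∀ n : ℕ, ((strictAperySet p (i + n * p)).ncard : ℝ) = (c (n % N)).eval (n : ℝ) := by
  refine exists_quasiPolynomial_ncard (ind_strictAperyCond_mem (i : ZMod p)) hi p p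
    (fun n => strictAperySet p (i + n * p)) (fun n w => ?_) fun n w hw j => ⟨hw.1.1 j, ?_⟩
  · change w ∈ aperySet p (i + n * p) ∧ _ ↔ _
    rw [mem_aperySet_iff]
    simp
  · exact apery_le hw.1 (by simpa using hc) j

/-! ### Comparison of the two counts -/

lemma finite_aperySet (hc : q.Coprime p) : (aperySet p q).Finite :=
  (Set.Finite.pi' fun _ : ZMod p => Set.finite_Icc (0 : ℤ) (p * q)).subset
    fun _ hw j => ⟨hw.1 j, apery_le hw hc j⟩

lemma ncard_strictAperySet_le (hc : q.Coprime p) :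
    (strictAperySet p q).ncard ≤ (aperySet p q).ncard :=
  Set.ncard_le_ncard (fun _ hw => hw.1) (finite_aperySet hc)

lemma ncard_aperySet_le (hq : (q : ZMod p) ≠ 0) (hc : q.Coprime p) :
    (aperySet p q).ncard ≤ (strictAperySet p (q + p)).ncard := by
  refine Set.ncard_le_ncard_of_injOn (fun w j => w j + if j = 0 then 0 else (p : ℤ)) ?_ ?_
    ((finite_aperySet (by simpa using hc)).subset fun _ hw => hw.1)
  · rintro w ⟨hnn, hres, h0, hadd, hwq⟩
    have hp : (0 : ℤ) < p := by exact_mod_cast NeZero.pos p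
    refine ⟨⟨fun j => ?_, fun j => ?_, ?_, fun j l => ?_, ?_⟩, fun j l hj hl hjl => ?_⟩
    · have := hnn j
      dsimp only
      split_ifs <;> omega
    · dsimp only
      split_ifs <;> simp [hres]
    · simpa using h0
    · have := hadd j l
      by_cases hj : j = 0
      · subst hj
        have := hnn 0
        simp only [zero_add, if_true] at *
        split_ifs <;> omega
      · simp only [hj, if_false]
        split_ifs <;> omega
    · simpa [hq] using hwq
    · have := hadd j l
      simp only [hj, hl, hjl, if_false]
      omega
  · intro w _ w' _ h
    ext j
    simpa using congrFun h j

lemma ncard_aperySet_le_pow (hc : q.Coprime p) :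
    (aperySet p q).ncard ≤ (p * q + 1) ^ (p - 1) := by
  classical
  refine (Set.ncard_le_ncard (t := (Fintype.piFinset fun j : ZMod p => if j = 0 then {0} else
    Finset.Icc (0 : ℤ) (p * q) : Finset (ZMod p → ℤ))) (fun w hw => ?_)
    (Finset.finite_toSet _)).trans ?_
  · rw [Finset.mem_coe, Fintype.mem_piFinset]
    intro j
    split_ifs with hj
    · simp [hj, aperySet_zero hw]
    · exact Finset.mem_Icc.2 ⟨hw.1 j, apery_le hw hc j⟩
  · rw [Set.ncard_coe_finset, Fintype.card_piFinset,
      ← Finset.mul_prod_erase _ _ (Finset.mem_univ 0)]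
    rw [Finset.prod_congr rfl fun j hj => by rw [if_neg (Finset.ne_of_mem_erase hj)]]
    simp [Finset.card_erase_of_mem, ZMod.card]
    norm_cast

lemma pow_le_ncard_aperySet (hc : i.Coprime p) (hi : (i : ZMod p) ≠ 0) (m : ℕ) :
    (m + 1) ^ (p - 1) ≤ (aperySet p (i + (2 * m) * p)).ncard := by
  classical
  have hcard : (Fintype.piFinset fun j : ZMod p => if j = 0 then {0} else
      Finset.Icc m (2 * m)).card = (m + 1) ^ (p - 1) := by
    rw [Fintype.card_piFinset, ← Finset.mul_prod_erase _ _ (Finset.mem_univ 0)]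
    rw [Finset.prod_congr rfl fun j hj => by rw [if_neg (Finset.ne_of_mem_erase hj)]]
    simp [Finset.card_erase_of_mem, ZMod.card]
    congr 1
    omega
  rw [← hcard, ← Set.ncard_coe_finset]
  have hp : 0 < p := NeZero.pos p
  refine Set.ncard_le_ncard_of_injOn (fun k j => ((j.val + p * k j : ℕ) : ℤ)) ?_ ?_
    (finite_aperySet (by simpa using hc))
  · intro k hk
    rw [Finset.mem_coe, Fintype.mem_piFinset] at hk
    have h0 : k 0 = 0 := by simpa using hk 0
    have hk' {j : ZMod p} (hj : j ≠ 0) : m ≤ k j ∧ k j ≤ 2 * m := by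
      simpa [hj] using hk j
    refine ⟨fun j => Nat.cast_nonneg _, fun j => by simp, by simp [h0], fun j l => ?_, ?_⟩
    · rw [← Nat.cast_add, Nat.cast_le]
      by_cases hj : j = 0
      · simp [hj]
      by_cases hl : l = 0
      · simp [hl]
      by_cases hjl : j + l = 0
      · simp [hjl, h0]
      have h1 := hk' hj
      have h2 := hk' hl
      have h3 := hk' hjl
      have hv := ZMod.val_add_le j l
      have : p * k (j + l) ≤ p * (k j + k l) := Nat.mul_le_mul_left _ (by omega)
      rw [mul_add] at this
      omega
    · have hii : ((i + 2 * m * p : ℕ) : ZMod p) = i := by simp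
      rw [hii, Nat.cast_le]
      have h1 : (i : ZMod p).val ≤ i := by
        rw [ZMod.val_natCast]
        exact Nat.mod_le _ _
      have h2 : p * k i ≤ 2 * m * p := by
        rw [mul_comm]
        exact Nat.mul_le_mul_right _ (hk' hi).2
      omega
  · intro k _ k' _ h
    ext j
    have := Nat.cast_injective (congrFun h j)
    exact Nat.eq_of_mul_eq_mul_left hp (Nat.add_left_cancel this)

end Count

section Asymptotics

open Polynomial Filter Topology

lemma natDegree_linear_subst (P : ℝ[X]) {a : ℝ} (ha : a ≠ 0) (b : ℝ) :
    (P.comp (C a * X + C b)).natDegree = P.natDegree := by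
  rw [natDegree_comp, natDegree_linear ha, mul_one]

lemma tendsto_eval_div_pow {P : ℝ[X]} {d : ℕ} (hP : P.natDegree ≤ d) {a : ℝ} (ha : a ≠ 0) (b : ℝ) :
    Tendsto (fun m : ℕ => P.eval (a * m + b) / (m : ℝ) ^ d) atTop (𝓝 (P.coeff d * a ^ d)) := by
  have hdeg := natDegree_linear_subst P ha b
  suffices h : Tendsto (fun x : ℝ => (P.comp (C a * X + C b)).eval x / (X ^ d : ℝ[X]).eval x)
      atTop (𝓝 (P.coeff d * a ^ d)) by
    simpa [Function.comp_def] using h.comp tendsto_natCast_atTop_atTop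
  rcases hP.lt_or_eq with hlt | rfl
  · rw [coeff_eq_zero_of_natDegree_lt hlt, zero_mul]
    refine div_tendsto_atTop_zero_of_degree_lt _ _ ?_
    rw [degree_X_pow]
    exact degree_le_natDegree.trans_lt (by exact_mod_cast hdeg.trans_lt hlt)
  · by_cases h0 : P = 0
    · simp [h0]
    have hne : P.comp (C a * X + C b) ≠ 0 := by
      intro h
      rcases comp_eq_zero_iff.1 h with h | ⟨-, h⟩
      · exact h0 h
      · have := congrArg natDegree h
        rw [natDegree_linear ha, natDegree_C] at this
        exact one_ne_zero this
    convert div_tendsto_atTop_leadingCoeff_div_of_degree_eq (P.comp (C a * X + C b))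
      (X ^ P.natDegree) ?_ using 2
    · rw [leadingCoeff_X_pow, div_one, leadingCoeff_comp (by rw [natDegree_linear ha]; simp),
        leadingCoeff_linear ha]
      rfl
    · rw [degree_X_pow, degree_eq_natDegree hne, hdeg]

lemma natDegree_le_of_growth {P : ℝ[X]} {d : ℕ} {a : ℝ} (ha : a ≠ 0) (b K : ℝ)
    (h : ∀ m : ℕ, |P.eval (a * m + b)| ≤ K * ((m : ℝ) + 1) ^ d) : P.natDegree ≤ d := by
  by_contra! hlt
  have hdeg := natDegree_linear_subst P ha b
  have hgt : (X ^ d : ℝ[X]).degree < (P.comp (C a * X + C b)).degree := by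
    rw [degree_X_pow]
    exact (degree_eq_natDegree (ne_zero_of_natDegree_gt (hdeg.symm ▸ hlt))) ▸
      Nat.cast_lt.2 (hdeg.symm ▸ hlt)
  have ht := (abs_div_tendsto_atTop_atTop_of_degree_gt _ _ hgt (by simp)).comp
    (tendsto_natCast_atTop_atTop (R := ℝ))
  obtain ⟨m, hm1, hm2⟩ := ((eventually_ge_atTop 1).and (ht.eventually_gt_atTop (K * 2 ^ d))).exists
  have hm1' : (1 : ℝ) ≤ m := by exact_mod_cast hm1
  have hK : 0 ≤ K := by simpa using (abs_nonneg _).trans (h 0)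
  simp only [Function.comp_apply, eval_comp, eval_add, eval_mul, eval_C, eval_X, eval_pow,
    abs_div, abs_pow, Nat.abs_cast] at hm2
  rw [lt_div_iff₀ (by positivity), mul_assoc, ← mul_pow] at hm2
  refine absurd (hm2.trans_le (h m)) (not_lt.2 ?_)
  gcongr
  linarith

/-- `f` agrees with the polynomials `c k`, `k < N`, on the residue classes modulo `N`. -/
def HasConstituents (f : ℕ → ℝ) (N : ℕ) (c : ℕ → ℝ[X]) : Prop :=
  0 < N ∧ ∀ n : ℕ, f n = (c (n % N)).eval (n : ℝ)

variable {f h : ℕ → ℝ} {N M : ℕ} {c c' : ℕ → ℝ[X]} {d : ℕ}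

lemma HasConstituents.eval_add_mul (hf : HasConstituents f N c) {k : ℕ} (hk : k < N) (M m s : ℕ) :
    (c k).eval (((N * M : ℕ) : ℝ) * m + (N * s + k : ℕ)) = f (N * M * m + (N * s + k)) := by
  rw [hf.2]
  have : (N * M * m + (N * s + k)) % N = k := by
    rw [mul_assoc, Nat.mul_add_mod, Nat.mul_add_mod, Nat.mod_eq_of_lt hk]
  rw [this]
  push_cast
  rfl

lemma HasConstituents.natDegree_le (hf : HasConstituents f N c) {K : ℝ} (hK : 0 ≤ K)
    (hb : ∀ n : ℕ, |f n| ≤ K * ((n : ℝ) + 1) ^ d) {k : ℕ} (hk : k < N) : (c k).natDegree ≤ d := by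
  refine natDegree_le_of_growth (a := ((N * 1 : ℕ) : ℝ)) (b := (N * 0 + k : ℕ)) (K := K * N ^ d)
    (by simpa using hf.1.ne') fun m => ?_
  rw [hf.eval_add_mul hk]
  refine (hb _).trans ?_
  rw [mul_assoc K, ← mul_pow]
  gcongr
  have : N * 1 * m + (N * 0 + k) + 1 ≤ N * (m + 1) := by
    simp only [mul_add, mul_one]
    omega
  exact_mod_cast this

lemma HasConstituents.coeff_le (hf : HasConstituents f N c) (hh : HasConstituents h M c')
    (hle : ∀ n n', n < n' → f n ≤ h n') (hd : ∀ k < N, (c k).natDegree ≤ d)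
    (hd' : ∀ k < M, (c' k).natDegree ≤ d) {k k' : ℕ} (hk : k < N) (hk' : k' < M) :
    (c k).coeff d ≤ (c' k').coeff d := by
  have hpos : (0 : ℝ) < (N * M : ℕ) := by exact_mod_cast Nat.mul_pos hf.1 hh.1
  have t1 := tendsto_eval_div_pow (hd k hk) hpos.ne' (N * 0 + k : ℕ)
  have t2 := tendsto_eval_div_pow (hd' k' hk') hpos.ne' (M * N + k' : ℕ)
  refine le_of_mul_le_mul_right (le_of_tendsto_of_tendsto' t1 t2 fun m => ?_)
    (pow_pos hpos d)
  rw [hf.eval_add_mul hk, mul_comm N M, hh.eval_add_mul hk']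
  gcongr
  refine hle _ _ ?_
  have : N ≤ M * N := Nat.le_mul_of_pos_left _ hh.1
  rw [mul_comm M N]
  rw [mul_comm M N] at this
  omega

/-- Two interlacing quasi-polynomial counting functions of order `n ^ d` have degree `d` and the
same constant leading coefficient. -/
lemma exists_common_leadingCoeff {f g : ℕ → ℕ} (hgf : ∀ n, g n ≤ f n) (hfg : ∀ n, f n ≤ g (n + 1))
    {K : ℝ} (hub : ∀ n : ℕ, (f n : ℝ) ≤ K * ((n : ℝ) + 1) ^ d)
    (hlb : ∀ m : ℕ, (m + 1) ^ d ≤ f (2 * m)) (hf : HasConstituents (fun n => f n) N c)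
    (hg : HasConstituents (fun n => g n) M c') :
    ∃ a : ℝ, a ≠ 0 ∧ (∀ k < N, (c k).natDegree ≤ d ∧ (c k).coeff d = a) ∧
      ∀ k < M, (c' k).natDegree ≤ d ∧ (c' k).coeff d = a := by
  have hK : 0 ≤ K := by simpa using (Nat.cast_nonneg _).trans (hub 0)
  have hdf : ∀ k < N, (c k).natDegree ≤ d := fun k hk =>
    hf.natDegree_le hK (fun n => by simpa using hub n) hk
  have hdg : ∀ k < M, (c' k).natDegree ≤ d := fun k hk =>
    hg.natDegree_le hK (fun n => by
      simpa using (Nat.cast_le.2 (hgf n)).trans (hub n)) hk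
  have hmono : Monotone f := monotone_nat_of_le_succ fun n => (hfg n).trans (hgf _)
  have hfg' {n n' : ℕ} (h : n < n') : f n ≤ g n' := by
    obtain ⟨s, rfl⟩ := Nat.exists_eq_add_of_lt h
    exact (hmono (Nat.le_add_right n s)).trans (hfg _)
  have hP : HasConstituents (fun n => ((n : ℝ) / 2) ^ d) 1 fun _ => C ((1 / 2 : ℝ) ^ d) * X ^ d :=
    ⟨one_pos, fun n => by
      simp only [eval_mul, eval_C, eval_pow, eval_X]
      ring⟩
  have h0 := hP.coeff_le hf (k := 0) (k' := 0) (d := d) (fun n n' h => by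
    have h1 : ((n : ℝ) / 2) ^ d ≤ ((n' / 2 : ℕ) + 1 : ℝ) ^ d := by
      gcongr
      rw [div_le_iff₀ two_pos]
      have : n ≤ (n' / 2 + 1) * 2 := by omega
      exact_mod_cast this
    refine h1.trans ?_
    exact_mod_cast (hlb (n' / 2)).trans (hmono (Nat.mul_div_le n' 2)))
    (fun _ _ => natDegree_C_mul_X_pow_le _ _) hdf one_pos hf.1
  rw [coeff_C_mul_X_pow, if_pos rfl] at h0
  refine ⟨(c 0).coeff d, ((by positivity : (0 : ℝ) < (1 / 2) ^ d).trans_le h0).ne',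
    fun k hk => ⟨hdf k hk, le_antisymm ?_ ?_⟩, fun k hk => ⟨hdg k hk, le_antisymm ?_ ?_⟩⟩
  · exact hf.coeff_le hf (fun n n' h => Nat.cast_le.2 (hmono h.le)) hdf hdf hk hf.1
  · exact hf.coeff_le hf (fun n n' h => Nat.cast_le.2 (hmono h.le)) hdf hdf hf.1 hk
  · exact hg.coeff_le hf (fun n n' h => Nat.cast_le.2 ((hgf n).trans (hmono h.le))) hdg hdf hk hf.1
  · exact hf.coeff_le hg (fun n n' h => Nat.cast_le.2 (hfg' h)) hdf hdg hf.1 hk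

end Asymptotics

/-- For `i ∈ {1,…,p-1}` coprime to `p`, the functions `n ↦ N(p, i+np)` and
`n ↦ Medim(p, i+np)` are quasi-polynomials of degree `p-1` with constant leading
coefficients, and these leading coefficients coincide. -/
theorem countNS_countMaxEdim_quasiPolynomial
    (p : ℕ) (hp : 3 ≤ p) (i : ℕ) (hi1 : 1 ≤ i) (hi2 : i ≤ p - 1)
    (hcop : Nat.Coprime i p) :
    ∃ a : ℝ,
      (∃ (N : ℕ) (c : ℕ → Polynomial ℝ), 0 < N ∧
        (∀ k < N, (c k).degree ≤ ((p - 1 : ℕ) : WithBot ℕ)) ∧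
        (∃ k < N, (c k).degree = ((p - 1 : ℕ) : WithBot ℕ)) ∧
        (∀ k < N, (c k).coeff (p - 1) = a) ∧
        (∀ n : ℕ, (countNS p (i + n * p) : ℝ) = (c (n % N)).eval (n : ℝ))) ∧
      (∃ (N : ℕ) (c : ℕ → Polynomial ℝ), 0 < N ∧
        (∀ k < N, (c k).degree ≤ ((p - 1 : ℕ) : WithBot ℕ)) ∧
        (∃ k < N, (c k).degree = ((p - 1 : ℕ) : WithBot ℕ)) ∧
        (∀ k < N, (c k).coeff (p - 1) = a) ∧
        (∀ n : ℕ, (countMaxEdim p (i + n * p) : ℝ) = (c (n % N)).eval (n : ℝ))) := by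
  have : NeZero p := ⟨by omega⟩
  have hi0 : (i : ZMod p) ≠ 0 := by
    rw [Ne, ZMod.natCast_eq_zero_iff]
    exact fun h => absurd (Nat.le_of_dvd hi1 h) (by omega)
  obtain ⟨N, c, hf⟩ := exists_quasiPolynomial_aperySet hi1 hcop
  obtain ⟨M, c', hg⟩ := exists_quasiPolynomial_strictAperySet hi1 hcop
  have hcop' (n : ℕ) : (i + n * p).Coprime p := by simpa using hcop
  obtain ⟨a, ha, h1, h2⟩ := exists_common_leadingCoeff (d := p - 1)
    (f := fun n => (aperySet p (i + n * p)).ncard)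
    (g := fun n => (strictAperySet p (i + n * p)).ncard)
    (K := ((p * i + p * p + 1 : ℕ) : ℝ) ^ (p - 1))
    (fun n => ncard_strictAperySet_le (hcop' n))
    (fun n => by
      have := ncard_aperySet_le (q := i + n * p) (by simpa using hi0) (hcop' n)
      rwa [add_assoc, ← Nat.succ_mul] at this)
    (fun n => by
      rw [← mul_pow]
      have : p * (i + n * p) + 1 ≤ (p * i + p * p + 1) * (n + 1) := by
        linarith [Nat.zero_le (p * i * n + p * p + n)]
      exact_mod_cast (ncard_aperySet_le_pow (hcop' n)).trans (Nat.pow_le_pow_left this (p - 1)))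
    (pow_le_ncard_aperySet hcop hi0) hf hg
  have hdeg {P : Polynomial ℝ} (h : P.natDegree ≤ p - 1 ∧ P.coeff (p - 1) = a) :
      P.degree = ((p - 1 : ℕ) : WithBot ℕ) :=
    Polynomial.degree_eq_of_le_of_coeff_ne_zero (Polynomial.natDegree_le_iff_degree_le.1 h.1)
      (h.2.symm ▸ ha)
  refine ⟨a, ⟨N, c, hf.1, fun k hk => (hdeg (h1 k hk)).le, ⟨0, hf.1, hdeg (h1 0 hf.1)⟩,
    fun k hk => (h1 k hk).2, fun n => ?_⟩, ⟨M, c', hg.1, fun k hk => (hdeg (h2 k hk)).le,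
    ⟨0, hg.1, hdeg (h2 0 hg.1)⟩, fun k hk => (h2 k hk).2, fun n => ?_⟩⟩
  · rw [countNS_eq_ncard]
    exact hf.2 n
  · rw [countMaxEdim_eq_ncard hp]
    exact hg.2 n
end

section
/- Let p ≥ 3 and q > p be coprime integers. Then the number of numerical semigroups of maximal embedding dimension p containing q equals the number of numerical semigroups containing both p and q−p; that is, Medim(p,q) = N(p, q−p). -/
/-- A cofinite set of naturals stable under adding `p > 0` has exactly `p` elements that are not
`p` plus another element. -/
theorem ncard_not_add_period {X : Set ℕ} {p : ℕ} (hp : 0 < p) (hX : ∀ x ∈ X, x + p ∈ X)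
    (hfin : Xᶜ.Finite) : {x | x ∈ X ∧ ∀ y ∈ X, x ≠ y + p}.ncard = p := by
  have hmul : ∀ x ∈ X, ∀ k, x + p * k ∈ X := by
    intro x hx k
    induction k with
    | zero => simpa using hx
    | succ k ih =>
      rw [Nat.mul_succ, ← add_assoc]
      exact hX _ ih
  have hlt : ∀ x ∈ X, ∀ y, (∀ z ∈ X, y ≠ z + p) → x % p = y % p → ¬ x < y := by
    intro x hx y hy hxy hlt
    obtain ⟨k, hk⟩ := (Nat.modEq_iff_dvd' hlt.le).1 hxy
    cases k with
    | zero => simp at hk; omega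
    | succ k => exact hy _ (hmul x hx k) (by rw [Nat.mul_succ] at hk; omega)
  have hinj : Set.InjOn (· % p) {x | x ∈ X ∧ ∀ y ∈ X, x ≠ y + p} := by
    rintro x ⟨hx, hx'⟩ y ⟨hy, hy'⟩ hxy
    have h1 := hlt x hx y hy' hxy
    have h2 := hlt y hy x hx' (Eq.symm hxy)
    omega
  have himg : (· % p) '' {x | x ∈ X ∧ ∀ y ∈ X, x ≠ y + p} = (Finset.range p : Set ℕ) := by
    ext r
    simp only [Set.mem_image, Finset.coe_range, Set.mem_Iio]
    constructor
    · rintro ⟨x, -, rfl⟩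
      exact Nat.mod_lt _ hp
    · intro hr
      have hex : ∃ k, r + p * k ∈ X := by
        by_contra! hno
        refine Set.infinite_of_injective_forall_mem (f := fun k => r + p * k) ?_ hno hfin
        intro a b hab
        exact Nat.eq_of_mul_eq_mul_left hp (Nat.add_left_cancel hab)
      classical
      refine ⟨r + p * Nat.find hex, ⟨Nat.find_spec hex, ?_⟩, ?_⟩
      · intro y hy hxy
        have hmin := fun m => Nat.find_min hex (m := m)
        generalize Nat.find hex = k at hxy hmin
        cases k with
        | zero => omega
        | succ k =>
          refine hmin k (Nat.lt_succ_self k) ?_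
          rw [Nat.mul_succ] at hxy
          rwa [show r + p * k = y by omega]
      · simp [Nat.mod_eq_of_lt hr]
  rw [← hinj.ncard_image, himg, Set.ncard_coe_finset, Finset.card_range]

/-- A numerical semigroup containing `p > 0` has embedding dimension `p` iff every sum of two
nonzero elements is `p` plus a nonzero element. -/
theorem edim_eq_iff {H : Set ℕ} {p : ℕ} (hH : IsNumericalSemigroup H) (hp : 0 < p) (hpH : p ∈ H) :
    edim H = p ↔ ∀ a ∈ H \ {0}, ∀ b ∈ H \ {0}, ∃ c ∈ H \ {0}, a + b = c + p := by
  obtain ⟨-, hadd, hfin⟩ := hH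
  have hcard : {x | x ∈ H \ {0} ∧ ∀ y ∈ H \ {0}, x ≠ y + p}.ncard = p := by
    refine ncard_not_add_period hp ?_ ?_
    · rintro x ⟨hx, -⟩
      exact ⟨hadd x hx p hpH, by simp; omega⟩
    · refine (hfin.union (Set.finite_singleton 0)).subset ?_
      intro x hx
      by_cases h0 : x = 0
      · exact Or.inr h0
      · exact Or.inl fun h => hx ⟨h, h0⟩
  have hsub : (H \ {0}) \ {n | ∃ a ∈ H \ {0}, ∃ b ∈ H \ {0}, n = a + b} ⊆
      {x | x ∈ H \ {0} ∧ ∀ y ∈ H \ {0}, x ≠ y + p} := by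
    rintro x ⟨hx, hx'⟩
    exact ⟨hx, fun y hy hxy => hx' ⟨y, hy, p, ⟨hpH, hp.ne'⟩, hxy⟩⟩
  constructor
  · intro h a ha b hb
    have heq := Set.eq_of_subset_of_ncard_le hsub (by rw [hcard]; exact h.ge)
      (Set.finite_of_ncard_pos (by omega))
    by_contra! hno
    have hmem : a + b ∈ {x | x ∈ H \ {0} ∧ ∀ y ∈ H \ {0}, x ≠ y + p} :=
      ⟨⟨hadd a ha.1 b hb.1, fun h0 => ha.2 (Nat.eq_zero_of_add_eq_zero_right h0)⟩, hno⟩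
    rw [← heq] at hmem
    exact hmem.2 ⟨a, ha, b, hb, rfl⟩
  · intro h
    rw [edim, hsub.antisymm ?_, hcard]
    rintro x ⟨hx, hx'⟩
    refine ⟨hx, ?_⟩
    rintro ⟨a, ha, b, hb, rfl⟩
    obtain ⟨c, hc, hcp⟩ := h a ha b hb
    exact hx' c hc hcp

/-- The set consisting of `0` and the translate of `T` by `p`. -/
def zeroUnionShift (p : ℕ) (T : Set ℕ) : Set ℕ := {n | n = 0 ∨ ∃ t ∈ T, n = t + p}

theorem add_mem_zeroUnionShift {p : ℕ} (hp : 0 < p) {T : Set ℕ} {n : ℕ} :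
    n + p ∈ zeroUnionShift p T ↔ n ∈ T := by
  constructor
  · rintro (h | ⟨t, ht, h⟩)
    · omega
    · rwa [Nat.add_right_cancel h]
  · exact fun h => Or.inr ⟨n, h, rfl⟩

theorem isNumericalSemigroup_zeroUnionShift {p : ℕ} {T : Set ℕ} (hT : IsNumericalSemigroup T)
    (hpT : p ∈ T) : IsNumericalSemigroup (zeroUnionShift p T) := by
  obtain ⟨-, hadd, hfin⟩ := hT
  refine ⟨Or.inl rfl, ?_, ?_⟩
  · rintro a (rfl | ⟨s, hs, rfl⟩) b (rfl | ⟨t, ht, rfl⟩)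
    · exact Or.inl rfl
    · exact Or.inr ⟨t, ht, by omega⟩
    · exact Or.inr ⟨s, hs, by omega⟩
    · exact Or.inr ⟨s + t + p, hadd _ (hadd s hs t ht) p hpT, by omega⟩
  · refine ((Set.finite_Iio p).union (hfin.image (· + p))).subset ?_
    intro x hx
    rcases lt_or_ge x p with h | h
    · exact Or.inl h
    · exact Or.inr ⟨x - p, fun hm => hx (Or.inr ⟨x - p, hm, by omega⟩), Nat.sub_add_cancel h⟩

theorem mult_zeroUnionShift {p : ℕ} (hp : 0 < p) {T : Set ℕ} (h0 : 0 ∈ T) :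
    mult (zeroUnionShift p T) = p := by
  refine IsLeast.csInf_eq ⟨⟨Or.inr ⟨0, h0, by omega⟩, hp⟩, ?_⟩
  rintro x ⟨rfl | ⟨t, -, rfl⟩, hx⟩ <;> omega

theorem edim_zeroUnionShift {p : ℕ} (hp : 0 < p) {T : Set ℕ} (hT : IsNumericalSemigroup T)
    (hpT : p ∈ T) : edim (zeroUnionShift p T) = p := by
  rw [edim_eq_iff (isNumericalSemigroup_zeroUnionShift hT hpT) hp (Or.inr ⟨0, hT.1, by omega⟩)]
  rintro a ⟨rfl | ⟨s, hs, rfl⟩, ha⟩ b ⟨rfl | ⟨t, ht, rfl⟩, hb⟩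
  · exact absurd rfl ha
  · exact absurd rfl ha
  · exact absurd rfl hb
  · exact ⟨s + t + p, ⟨Or.inr ⟨s + t, hT.2.1 s hs t ht, rfl⟩, by simp; omega⟩, by omega⟩

/-- Every numerical semigroup of maximal embedding dimension `p` arises from a numerical
semigroup containing `p` by `zeroUnionShift`. -/
theorem exists_zeroUnionShift_eq {p : ℕ} (hp : 0 < p) {H : Set ℕ} (hH : IsNumericalSemigroup H)
    (hm : mult H = p) (he : edim H = p) :
    ∃ T, IsNumericalSemigroup T ∧ p ∈ T ∧ zeroUnionShift p T = H := by
  have hpH : p ∈ H := by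
    have hne : {n | n ∈ H ∧ 0 < n}.Nonempty := by
      refine Set.nonempty_iff_ne_empty.2 fun h => ?_
      rw [mult, h, Nat.sInf_empty] at hm
      omega
    exact hm ▸ (Nat.sInf_mem hne).1
  have hle : ∀ x ∈ H, x ≠ 0 → p ≤ x := fun x hx h0 =>
    hm ▸ Nat.sInf_le ⟨hx, Nat.pos_of_ne_zero h0⟩
  have hsum := (edim_eq_iff hH hp hpH).1 he
  obtain ⟨h0, hadd, hfin⟩ := hH
  refine ⟨{t | t + p ∈ H}, ⟨by simpa using hpH, ?_, ?_⟩, hadd p hpH p hpH, ?_⟩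
  · intro a ha b hb
    obtain ⟨c, hc, h⟩ := hsum (a + p) ⟨ha, by simp; omega⟩ (b + p) ⟨hb, by simp; omega⟩
    rw [Set.mem_ofPred_eq, show a + b + p = c by omega]
    exact hc.1
  · exact hfin.preimage (f := (· + p)) (add_left_injective p).injOn
  · ext x
    constructor
    · rintro (rfl | ⟨t, ht, rfl⟩)
      · exact h0
      · exact ht
    · intro hx
      by_cases hx0 : x = 0
      · exact Or.inl hx0
      · have hpx := Nat.sub_add_cancel (hle x hx hx0)
        exact Or.inr ⟨x - p, by rwa [Set.mem_ofPred_eq, hpx], hpx.symm⟩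

/-- For coprime `q > p ≥ 3`, `Medim(p,q) = N(p, q - p)`. -/
theorem countMaxEdim_eq_countNS
    (p q : ℕ) (hp : 3 ≤ p) (hq : p < q) (hcop : Nat.Coprime p q) :
    countMaxEdim p q = countNS p (q - p) := by
  have hp0 : 0 < p := by omega
  have hqp : q - p + p = q := Nat.sub_add_cancel hq.le
  have hinj : Function.Injective (zeroUnionShift p) := by
    intro S T h
    ext n
    rw [← add_mem_zeroUnionShift hp0, h, add_mem_zeroUnionShift hp0]
  refine Eq.trans (congrArg Set.ncard ?_) (Set.ncard_image_of_injective _ hinj)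
  ext H
  constructor
  · rintro ⟨hH, hm, he, hqH⟩
    obtain ⟨T, hT, hpT, rfl⟩ := exists_zeroUnionShift_eq hp0 hH hm he
    exact ⟨T, ⟨hT, hpT, (add_mem_zeroUnionShift hp0).1 (hqp.symm ▸ hqH)⟩, rfl⟩
  · rintro ⟨T, ⟨hT, hpT, hqT⟩, rfl⟩
    exact ⟨isNumericalSemigroup_zeroUnionShift hT hpT, mult_zeroUnionShift hp0 hT.1,
      edim_zeroUnionShift hp0 hT hpT, hqp ▸ (add_mem_zeroUnionShift hp0).2 hqT⟩
end
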